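/- Let U_s be an admissible shear flow satisfying the weighted decay conditions for a weight ω, and let η > 0. There exist constants C, K > 0 such that for every μ ∈ ℂ with Im μ ≥ η and every integer k ≥ K, |Φ(μ, k) − Φ_inv(μ)| ≤ C k^{−1/2}, where Φ(μ, k) := lim_{y→∞} φ(y) and φ is the unique solution of (μ − U_s)φ' + U_s' φ − (i/k) φ''' = F with φ(0) = 0, φ'(0) = 1, φ'(y) → 0 as y → ∞. -/

import Mathlib

open MeasureTheory Filter Set

noncomputable section

/-- The source term `F(y) = 1 - U(y) + y U'(y)` of the eigenmode ODE. -/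
def srcF (U : ℝ → ℝ) (y : ℝ) : ℝ := 1 - U y + y * deriv U y

/-- The displacement thickness `Δ_s = ∫₀^∞ (1 - U)`. -/
def deltaS (U : ℝ → ℝ) : ℝ := ∫ y in Ioi (0:ℝ), (1 - U y)

/-- An admissible shear flow: smooth, monotone, `U(0) = 0`, `U → 1`,
`U''(0) ≠ 0`, finitely many inflexion points, and the decay conditions of the paper. -/
structure AdmissibleShearFlow (U : ℝ → ℝ) : Prop where
  smooth : ContDiff ℝ (⊤ : ℕ∞) U
  mem_Ico : ∀ y, 0 ≤ y → U y ∈ Ico (0:ℝ) 1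
  zero_val : U 0 = 0
  deriv_pos : ∀ y, 0 ≤ y → 0 < deriv U y
  tendsto_one : Tendsto U atTop (nhds 1)
  snd_deriv_zero_ne : iteratedDeriv 2 U 0 ≠ 0
  finite_inflexions : {y : ℝ | 0 < y ∧ iteratedDeriv 2 U y = 0}.Finite
  integrable_defect : IntegrableOn (fun y => 1 - U y) (Ioi (0:ℝ))
  derivs_bounded : ∀ j : ℕ, 1 ≤ j → j ≤ 3 →
    ∃ M : ℝ, ∀ y, 0 ≤ y → |iteratedDeriv j U y| ≤ M
  decay_ratio₁ : Tendsto (fun y => (1 - U y) ^ 2 / deriv U y) atTop (nhds 0)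
  decay_ratio₂ : Tendsto (fun y => y * (1 - U y)) atTop (nhds 0)
  decay_ratio₃ : IntegrableOn
    (fun y => (1 - U y) ^ 2 * iteratedDeriv 2 U y / (deriv U y) ^ 2) (Ioi (0:ℝ))
  kappa_decay : ∃ κ : ℝ, 0 < κ ∧ κ < 1/2 ∧ ∃ yκ > (0:ℝ), ∃ cκ > (0:ℝ),
    ∀ y, yκ ≤ y →
      (1 - U y) ^ ((2:ℝ) - κ) * iteratedDeriv 2 U y ≤ -cκ * (deriv U y) ^ 3

/-- `φ` is a smooth solution of the eigenmode problem
`(μ - U_s)φ' + U_s'φ - (i/k)φ''' = F`, `φ(0) = 0`, `φ'(0) = 1`, `φ' → 0`, `φ → L`. -/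
def IsEigSolution (U : ℝ → ℝ) (μ : ℂ) (k : ℝ) (L : ℂ) (φ : ℝ → ℂ) : Prop :=
  ContDiff ℝ (⊤ : ℕ∞) φ ∧
  (∀ y, 0 ≤ y →
    (μ - (U y : ℂ)) * deriv φ y + ((deriv U y : ℝ) : ℂ) * φ y
      - Complex.I / (k : ℂ) * iteratedDeriv 3 φ y = (srcF U y : ℂ)) ∧
  φ 0 = 0 ∧ deriv φ 0 = 1 ∧
  Tendsto (deriv φ) atTop (nhds 0) ∧
  Tendsto φ atTop (nhds L)

/-- Same problem without the prescribed limit at infinity. -/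
def IsBLSolution (U : ℝ → ℝ) (μ : ℂ) (k : ℝ) (φ : ℝ → ℂ) : Prop :=
  ContDiff ℝ (⊤ : ℕ∞) φ ∧
  (∀ y, 0 ≤ y →
    (μ - (U y : ℂ)) * deriv φ y + ((deriv U y : ℝ) : ℂ) * φ y
      - Complex.I / (k : ℂ) * iteratedDeriv 3 φ y = (srcF U y : ℂ)) ∧
  φ 0 = 0 ∧ deriv φ 0 = 1 ∧ Tendsto (deriv φ) atTop (nhds 0)

/-- Cauchy principal value `PV ∫₀¹ h(u)/(u - a) du`. -/
def pvIntegral (h : ℝ → ℝ) (a : ℝ) : ℝ :=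
  limUnder (nhdsWithin (0:ℝ) (Ioi 0))
    (fun ε => ∫ u in Ioo (0:ℝ) 1 \ Ioo (a - ε) (a + ε), h u / (u - a))

/-- Inverse of the shear flow on `[0, ∞)`. -/
def shearInv (U : ℝ → ℝ) (u : ℝ) : ℝ := Function.invFunOn U (Ici 0) u

/-- `g(u) = (1-u)² U''(U⁻¹(u)) / (U'(U⁻¹(u)))³`. -/
def gfun (U : ℝ → ℝ) (u : ℝ) : ℝ :=
  (1 - u) ^ 2 * iteratedDeriv 2 U (shearInv U u) / (deriv U (shearInv U u)) ^ 3

/-- `G(a) = 1/(a U'(0)) + PV ∫₀¹ g(u)/(u-a) du + iπ g(a)`. -/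
def Gfun (U : ℝ → ℝ) (a : ℝ) : ℂ :=
  ((1 / (a * deriv U 0) + pvIntegral (gfun U) a : ℝ) : ℂ)
    + Complex.I * ((Real.pi * gfun U a : ℝ) : ℂ)

/-- Crossing abscissa `χ(y) = Re G(U(y))`. -/
def chiAbscissa (U : ℝ → ℝ) (y : ℝ) : ℝ := (Gfun U (U y)).re

/-- `ξ(γ)`: number of zeros of `U''` in `(0,∞)` with `χ(yᵢ) = γ`. -/
def xiEq (U : ℝ → ℝ) (γ : ℝ) : ℕ :=
  {y : ℝ | 0 < y ∧ iteratedDeriv 2 U y = 0 ∧ chiAbscissa U y = γ}.ncard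

/-- `ξ₊(γ)`: zeros of `U''` with `χ(yᵢ) < γ`, `U'' < 0` on the left and `U'' > 0`
on the right. -/
def xiPlus (U : ℝ → ℝ) (γ : ℝ) : ℕ :=
  {y : ℝ | 0 < y ∧ iteratedDeriv 2 U y = 0 ∧ chiAbscissa U y < γ ∧
    ∃ δ > (0:ℝ), (∀ z ∈ Ioo (y - δ) y, iteratedDeriv 2 U z < 0) ∧
      (∀ z ∈ Ioo y (y + δ), 0 < iteratedDeriv 2 U z)}.ncard

/-- `ξ₋(γ)`: zeros of `U''` with `χ(yᵢ) < γ`, `U'' > 0` on the left and `U'' < 0`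
on the right. -/
def xiMinus (U : ℝ → ℝ) (γ : ℝ) : ℕ :=
  {y : ℝ | 0 < y ∧ iteratedDeriv 2 U y = 0 ∧ chiAbscissa U y < γ ∧
    ∃ δ > (0:ℝ), (∀ z ∈ Ioo (y - δ) y, 0 < iteratedDeriv 2 U z) ∧
      (∀ z ∈ Ioo y (y + δ), iteratedDeriv 2 U z < 0)}.ncard

/-- `Φ_inv(μ) = (μ - 1) ∫₀^∞ F(y)/(μ - U(y))² dy`. -/
def PhiInv (U : ℝ → ℝ) (μ : ℂ) : ℂ :=
  (μ - 1) * ∫ y in Ioi (0:ℝ), (srcF U y : ℂ) / (μ - (U y : ℂ)) ^ 2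

/-- A weight function `ω ≥ 1` with `C_ω < ∞`. -/
structure WeightFn (ω : ℝ → ℝ) : Prop where
  pos : ∀ y, 0 ≤ y → 0 < ω y
  contDiff : ContDiff ℝ 1 ω
  one_le : ∀ y, 0 ≤ y → 1 ≤ ω y
  integrable_inv : IntegrableOn (fun y => 1 / ω y) (Ioi (0:ℝ))
  deriv_ratio_bdd : ∃ M : ℝ, ∀ y, 0 ≤ y → |deriv ω y / ω y| ≤ M
  log_ratio_bdd : ∃ M : ℝ, ∀ y, 0 ≤ y → Real.log (ω y) / (1 + y) ≤ M

/-- Weighted decay conditions: `(1-U_s) ∈ L²(ω)` and `(1+y)U_s^{(j)} ∈ L²(ω)`, `j = 1,2,3`. -/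
def WeightedDecay (U ω : ℝ → ℝ) : Prop :=
  IntegrableOn (fun y => (1 - U y) ^ 2 * ω y) (Ioi (0:ℝ)) ∧
  ∀ j : ℕ, 1 ≤ j → j ≤ 3 →
    IntegrableOn (fun y => ((1 + y) * iteratedDeriv j U y) ^ 2 * ω y) (Ioi (0:ℝ))

/-- Membership in the weighted space `L²(ω)`. -/
def MemL2w (ω : ℝ → ℝ) (f : ℝ → ℂ) : Prop :=
  IntegrableOn (fun y => ‖f y‖ ^ 2 * ω y) (Ioi (0:ℝ))

/-- The `L²(ω)` norm. -/
def wNorm (ω : ℝ → ℝ) (f : ℝ → ℂ) : ℝ :=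
  Real.sqrt (∫ y in Ioi (0:ℝ), ‖f y‖ ^ 2 * ω y)

/-- `φ` solves the homogeneous-boundary-conditions resolvent problem with forcing `f`. -/
def SolvesHom (U : ℝ → ℝ) (μ : ℂ) (k : ℝ) (f φ : ℝ → ℂ) : Prop :=
  ContDiff ℝ 2 φ ∧
  (∀ᵐ y ∂(volume.restrict (Ioi (0:ℝ))),
    (μ - (U y : ℂ)) * deriv φ y + ((deriv U y : ℝ) : ℂ) * φ y
      - Complex.I / (k : ℂ) * iteratedDeriv 3 φ y = f y) ∧
  φ 0 = 0 ∧ deriv φ 0 = 0 ∧ Tendsto (deriv φ) atTop (nhds 0)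

/-- Parameterization on `[0,1]` of the contour `C_η`: the segment from `iη` to `1 + iη`
followed by the upper half-circle of radius `1/2` centered at `1/2 + iη`. -/
def Ceta (η : ℝ) (t : ℝ) : ℂ :=
  if t ≤ 1/2 then ((2*t : ℝ) : ℂ) + (η : ℂ) * Complex.I
  else (1/2 : ℂ) + (η : ℂ) * Complex.I
    + (1/2 : ℂ) * Complex.exp (((Real.pi * (2*t - 1) : ℝ)) * Complex.I)

/-- Winding number `(1/2πi) ∮ dz/(z - p)` of a closed curve parameterized on `[0,1]`. -/
def windingNumber (c : ℝ → ℂ) (p : ℂ) : ℂ :=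
  (((2 * Real.pi : ℝ) : ℂ) * Complex.I)⁻¹ * ∫ t in (0:ℝ)..1, deriv c t / (c t - p)

/-- `q_μ(x) = |μ - x|⁴ - (2μ - 1 - x)(μ̄ - x)²`. -/
def qmu (μ : ℂ) (x : ℝ) : ℂ :=
  ((‖μ - (x:ℂ)‖ ^ 4 : ℝ) : ℂ) - (2*μ - 1 - (x:ℂ)) * ((starRingEnd ℂ) μ - (x:ℂ))^2

/-- `f(α) = -2iΔ_s/α + 1/√α`, principal square root (positive real part for `Re α > 0`). -/
def fIBL (Δ : ℝ) (α : ℂ) : ℂ := (-2 * Complex.I * (Δ:ℂ)) / α + 1 / (α ^ (1/2 : ℂ))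

section
open MeasureTheory Filter Set
noncomputable section

structure FlowDat (U u1 u2 u3 : ℝ → ℝ) (B : ℝ) : Prop where
  d0 : ∀ y, HasDerivAt U (u1 y) y
  d1 : ∀ y, HasDerivAt u1 (u2 y) y
  d2 : ∀ y, HasDerivAt u2 (u3 y) y
  c3 : Continuous u3
  U01 : ∀ y, 0 ≤ y → 0 ≤ U y ∧ U y ≤ 1
  b1 : ∀ y, 0 ≤ y → |u1 y| ≤ B
  b2 : ∀ y, 0 ≤ y → |u2 y| ≤ B
  b3 : ∀ y, 0 ≤ y → |u3 y| ≤ B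
  one_le : 1 ≤ B
  I1 : ∀ R, 0 ≤ R → ∫ y in (0:ℝ)..R, (1 + y) * (|u1 y| + |u2 y| + |u3 y|) ≤ B
  I2 : ∀ R, 0 ≤ R → ∫ y in (0:ℝ)..R, ((1 + y) * (|u1 y| + |u2 y| + |u3 y|))^2 ≤ B
  bF : ∀ y, 0 ≤ y → |1 - U y + y * u1 y| ≤ B
  IF : ∀ R, 0 ≤ R → ∫ y in (0:ℝ)..R, |1 - U y + y * u1 y| ≤ B

namespace FlowDat
variable {U u1 u2 u3 : ℝ → ℝ} {B : ℝ}
theorem cU (h : FlowDat U u1 u2 u3 B) : Continuous U :=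
  continuous_iff_continuousAt.2 fun y => (h.d0 y).continuousAt
theorem c1 (h : FlowDat U u1 u2 u3 B) : Continuous u1 :=
  continuous_iff_continuousAt.2 fun y => (h.d1 y).continuousAt
theorem c2 (h : FlowDat U u1 u2 u3 B) : Continuous u2 :=
  continuous_iff_continuousAt.2 fun y => (h.d2 y).continuousAt
end FlowDat

/-- The unknown with its first three derivatives and its equation on the half line. -/
structure QSol (U u1 u2 u3 : ℝ → ℝ) (μ : ℂ) (k : ℝ) (g Ψ q r s : ℝ → ℂ) : Prop where
  z : Ψ 0 = 0
  dΨ : ∀ y, HasDerivAt Ψ (q y) y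
  dq : ∀ y, HasDerivAt q (r y) y
  dr : ∀ y, HasDerivAt r (s y) y
  cs : Continuous s
  cg : Continuous g
  eq : ∀ y, 0 ≤ y → s y = -Complex.I * k * (μ - U y) * q y - g y
    + (3 * u1 y * r y + 3 * u2 y * q y + u3 y * Ψ y) / (μ - U y)

namespace QSol
variable {U u1 u2 u3 : ℝ → ℝ} {μ : ℂ} {k : ℝ} {g Ψ q r s : ℝ → ℂ}
theorem cΨ (h : QSol U u1 u2 u3 μ k g Ψ q r s) : Continuous Ψ :=
  continuous_iff_continuousAt.2 fun y => (h.dΨ y).continuousAt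
theorem cq (h : QSol U u1 u2 u3 μ k g Ψ q r s) : Continuous q :=
  continuous_iff_continuousAt.2 fun y => (h.dq y).continuousAt
theorem cr (h : QSol U u1 u2 u3 μ k g Ψ q r s) : Continuous r :=
  continuous_iff_continuousAt.2 fun y => (h.dr y).continuousAt

/-- Cauchy-Schwarz bound on `Ψ`. -/
theorem psi_sq (h : QSol U u1 u2 u3 μ k g Ψ q r s) (y : ℝ) (hy : 0 ≤ y) :
    ‖Ψ y‖ ^ 2 ≤ y * ∫ t in (0:ℝ)..y, ‖q t‖ ^ 2 := by
  rcases hy.eq_or_lt with rfl | hy0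
  · simp [h.z]
  have cq := h.cq
  have e1 : Ψ y = ∫ t in (0:ℝ)..y, q t := by
    rw [intervalIntegral.integral_eq_sub_of_hasDerivAt (fun x _ => h.dΨ x)
      (cq.intervalIntegrable _ _), h.z, sub_zero]
  set I := ∫ t in (0:ℝ)..y, ‖q t‖ with hI
  have e2 : ‖Ψ y‖ ≤ I := by
    rw [e1]; exact intervalIntegral.norm_integral_le_integral_norm hy
  have e3 : 0 ≤ ∫ t in (0:ℝ)..y, (‖q t‖ - I / y) ^ 2 :=
    intervalIntegral.integral_nonneg hy (fun t _ => sq_nonneg _)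
  have e4 : ∫ t in (0:ℝ)..y, (‖q t‖ - I / y) ^ 2
      = (∫ t in (0:ℝ)..y, ‖q t‖ ^ 2) - I ^ 2 / y := by
    have : ∀ t, (‖q t‖ - I / y) ^ 2 = ‖q t‖ ^ 2 - (2 * (I / y)) * ‖q t‖ + (I / y) ^ 2 := by
      intro t; ring
    simp_rw [this]
    rw [intervalIntegral.integral_add, intervalIntegral.integral_sub,
      intervalIntegral.integral_const_mul, ← hI]
    · simp
      field_simp
      ring
    all_goals apply Continuous.intervalIntegrable; fun_prop
  rw [e4] at e3
  have e5 : I ^ 2 ≤ y * ∫ t in (0:ℝ)..y, ‖q t‖ ^ 2 := by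
    have : I ^ 2 / y ≤ ∫ t in (0:ℝ)..y, ‖q t‖ ^ 2 := by linarith
    rw [div_le_iff₀ hy0] at this; linarith
  exact (pow_le_pow_left₀ (norm_nonneg _) e2 2).trans e5

theorem N_mono (h : QSol U u1 u2 u3 μ k g Ψ q r s) {y R : ℝ} (hy : 0 ≤ y) (hyR : y ≤ R) :
    ∫ t in (0:ℝ)..y, ‖q t‖ ^ 2 ≤ ∫ t in (0:ℝ)..R, ‖q t‖ ^ 2 := by
  have cq := h.cq
  apply intervalIntegral.integral_mono_interval le_rfl hy hyR
  · exact Eventually.of_forall fun t => sq_nonneg _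
  · apply Continuous.intervalIntegrable; fun_prop

theorem psi_sq' (h : QSol U u1 u2 u3 μ k g Ψ q r s) {y R : ℝ} (hy : 0 ≤ y) (hyR : y ≤ R) :
    ‖Ψ y‖ ^ 2 ≤ y * ∫ t in (0:ℝ)..R, ‖q t‖ ^ 2 :=
  (h.psi_sq y hy).trans (mul_le_mul_of_nonneg_left (h.N_mono hy hyR) hy)

theorem u3psi {B : ℝ} (hd : FlowDat U u1 u2 u3 B)
    (h : QSol U u1 u2 u3 μ k g Ψ q r s) {b R : ℝ} (hb : 0 ≤ b) (hR : b ≤ R) :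
    ∫ y in (0:ℝ)..b, (u3 y) ^ 2 * ‖Ψ y‖ ^ 2 ≤ B * ∫ t in (0:ℝ)..R, ‖q t‖ ^ 2 := by
  have cΨ := h.cΨ
  have c1 := hd.c1
  have c2 := hd.c2
  have c3 := hd.c3
  set N := ∫ t in (0:ℝ)..R, ‖q t‖ ^ 2 with hN
  have hN0 : 0 ≤ N := intervalIntegral.integral_nonneg (hb.trans hR) (fun t _ => sq_nonneg _)
  have e1 : ∫ y in (0:ℝ)..b, (u3 y) ^ 2 * ‖Ψ y‖ ^ 2 ≤
      ∫ y in (0:ℝ)..b, ((1 + y) * (|u1 y| + |u2 y| + |u3 y|))^2 * N := by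
    apply intervalIntegral.integral_mono_on hb
    · apply Continuous.intervalIntegrable; fun_prop
    · apply Continuous.intervalIntegrable; fun_prop
    intro y hy
    have p := h.psi_sq' hy.1 (hy.2.trans hR)
    have q1 : (u3 y)^2 * y ≤ ((1 + y) * (|u1 y| + |u2 y| + |u3 y|))^2 := by
      have a1 : |u3 y| ^ 2 ≤ (|u1 y| + |u2 y| + |u3 y|)^2 := by
        apply pow_le_pow_left₀ (abs_nonneg _)
        have := abs_nonneg (u1 y); have := abs_nonneg (u2 y); linarith
      rw [sq_abs] at a1
      rw [mul_pow]
      have a2 : y ≤ (1 + y)^2 := by nlinarith [hy.1]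
      calc (u3 y)^2 * y = y * (u3 y)^2 := by ring
        _ ≤ _ := mul_le_mul a2 a1 (sq_nonneg _) (sq_nonneg _)
    calc (u3 y) ^ 2 * ‖Ψ y‖ ^ 2 ≤ (u3 y)^2 * (y * N) := by gcongr
      _ = ((u3 y)^2 * y) * N := by ring
      _ ≤ _ := mul_le_mul_of_nonneg_right q1 hN0
  refine e1.trans ?_
  rw [intervalIntegral.integral_mul_const]
  exact mul_le_mul_of_nonneg_right (hd.I2 b hb) hN0

theorem a_im (y : ℝ) : (μ - U y).im = μ.im := by simp

theorem a_low {η : ℝ} (hμ : η ≤ μ.im) (y : ℝ) : η ≤ ‖μ - U y‖ := by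
  have := Complex.abs_im_le_norm (μ - U y)
  rw [a_im] at this
  exact hμ.trans ((le_abs_self _).trans this)

theorem w_bd {B η : ℝ} (hη : 0 < η) (hμ : η ≤ μ.im) (hd : FlowDat U u1 u2 u3 B)
    (y : ℝ) (hy : 0 ≤ y) (ψ p p' : ℂ) :
    ‖(3 * u1 y * p' + 3 * u2 y * p + u3 y * ψ) / (μ - U y)‖
      ≤ (3 * B * ‖p'‖ + 3 * B * ‖p‖ + |u3 y| * ‖ψ‖) / η := by
  rw [norm_div]
  have := a_low (U := U) hμ y
  have hB : 0 ≤ B := zero_le_one.trans hd.one_le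
  apply div_le_div₀ _ _ hη this
  · positivity
  · refine (norm_add₃_le).trans ?_
    simp only [norm_mul, Complex.norm_real, Real.norm_eq_abs, Complex.norm_ofNat]
    have := hd.b1 y hy
    have := hd.b2 y hy
    gcongr

def K1 (B η : ℝ) : ℝ := 9*B^2/(2*η^2) + 3*B/η + 1/(2*η) + 1/2 + B/(2*η)

theorem energy1 {B η R : ℝ} (hη : 0 < η) (hμ : η ≤ μ.im) (hd : FlowDat U u1 u2 u3 B)
    (h : QSol U u1 u2 u3 μ k g Ψ q r s) (hR : 0 ≤ R) (hk : 0 ≤ k) (hkK : 2 * K1 B η ≤ k * η) :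
    (∫ y in (0:ℝ)..R, ‖r y‖^2) + k * η * (∫ y in (0:ℝ)..R, ‖q y‖^2)
      ≤ 2 * (‖q R‖ * ‖r R‖ + ‖q 0‖ * ‖r 0‖) + ∫ y in (0:ℝ)..R, ‖g y‖^2 := by
  have cΨ := h.cΨ
  have cq := h.cq
  have cr := h.cr
  have cs := h.cs
  have cg := h.cg
  have c3 := hd.c3
  have hB := hd.one_le
  set D := ∫ y in (0:ℝ)..R, ‖r y‖^2 with hD
  set N := ∫ y in (0:ℝ)..R, ‖q y‖^2 with hN
  set Γ := ∫ y in (0:ℝ)..R, ‖g y‖^2 with hΓ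
  set Z := ∫ y in (0:ℝ)..R, (u3 y) ^ 2 * ‖Ψ y‖ ^ 2 with hZ
  have hN0 : 0 ≤ N := intervalIntegral.integral_nonneg hR (fun t _ => sq_nonneg _)
  have hZN : Z ≤ B * N := h.u3psi hd hR le_rfl
  have ftc : ∫ y in (0:ℝ)..R, (inner ℝ (q y) (s y) + inner ℝ (r y) (r y))
      = inner ℝ (q R) (r R) - inner ℝ (q 0) (r 0) := by
    refine intervalIntegral.integral_eq_sub_of_hasDerivAt
      (f := fun y => inner ℝ (q y) (r y)) (fun y _ => (h.dq y).inner ℝ (h.dr y)) ?_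
    apply Continuous.intervalIntegrable; fun_prop
  set C1 : ℝ := 9*B^2/(2*η^2) + 3*B/η + 1/(2*η) + 1/2 with hC1
  have pt : ∀ y ∈ Icc 0 R, (1/2) * ‖r y‖^2 + (k * η - C1) * ‖q y‖^2
      - (1/(2*η)) * ((u3 y)^2 * ‖Ψ y‖^2) - (1/2) * ‖g y‖^2
      ≤ inner ℝ (q y) (s y) + inner ℝ (r y) (r y) := by
    intro y hy
    set T := (3 * u1 y * r y + 3 * u2 y * q y + u3 y * Ψ y) / (μ - U y) with hT
    have hw : ‖T‖ ≤ _ := w_bd hη hμ hd y hy.1 (Ψ y) (q y) (r y)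
    have e1 : inner ℝ (q y) (s y) = k * μ.im * ‖q y‖^2 + inner ℝ (q y) (T - g y) := by
      rw [h.eq y hy.1, ← hT, show -Complex.I * k * (μ - U y) * q y - g y + T
        = -Complex.I * k * (μ - U y) * q y + (T - g y) by ring, inner_add_right]
      congr 1
      rw [Complex.inner, Complex.sq_norm, Complex.normSq_apply]
      simp [Complex.mul_re, Complex.mul_im]
      ring
    have e2 : -(‖q y‖ * (‖T‖ + ‖g y‖)) ≤ inner ℝ (q y) (T - g y) := by
      have a1 := abs_real_inner_le_norm (q y) (T - g y)
      have a2 := norm_sub_le T (g y)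
      have a3 := neg_abs_le (inner ℝ (q y) (T - g y))
      have a4 : ‖q y‖ * ‖T - g y‖ ≤ ‖q y‖ * (‖T‖ + ‖g y‖) := by gcongr
      linarith
    rw [e1, real_inner_self_eq_norm_sq]
    set X := ‖q y‖
    set Y := ‖r y‖
    set P := ‖Ψ y‖
    set G := ‖g y‖
    have hX : 0 ≤ X := norm_nonneg _
    have e3 : k * η * X^2 ≤ k * μ.im * X^2 := by gcongr
    have e4 : X * ‖T‖ ≤ X * ((3 * B * Y + 3 * B * X + |u3 y| * P) / η) := by gcongr
    have e5 : X * ((3 * B * Y + 3 * B * X + |u3 y| * P) / η)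
        ≤ (1/2) * Y^2 + (C1 - 1/2) * X^2 + (1/(2*η)) * ((u3 y)^2 * P^2) := by
      have s1 : 0 ≤ (Y - 3*B/η * X)^2 := sq_nonneg _
      have s2 : 0 ≤ (1/(2*η)) * (|u3 y| * P - X)^2 := by positivity
      have s3 : (1/(2*η)) * (|u3 y| * P - X)^2 = (1/(2*η)) * ((u3 y)^2 * P^2)
          - (1/η) * (|u3 y| * P * X) + (1/(2*η)) * X^2 := by
        rw [← sq_abs (u3 y)]; ring
      have s4 : X * ((3 * B * Y + 3 * B * X + |u3 y| * P) / η)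
        = 3*B/η * X * Y + 3*B/η * X^2 + (1/η) * (|u3 y| * P * X) := by ring
      have s5 : (Y - 3*B/η * X)^2 = Y^2 - 2 * (3*B/η * X * Y) + 2 * (9*B^2/(2*η^2)) * X^2 := by
        field_simp; ring
      rw [s4, hC1]
      nlinarith [s1, s2, s3, s5]
    nlinarith [sq_nonneg (X - G)]
  have mono := intervalIntegral.integral_mono_on (μ := volume) hR
    (f := fun y => (1/2) * ‖r y‖^2 + (k * η - C1) * ‖q y‖^2
      - (1/(2*η)) * ((u3 y)^2 * ‖Ψ y‖^2) - (1/2) * ‖g y‖^2)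
    (g := fun y => inner ℝ (q y) (s y) + inner ℝ (r y) (r y))
    (by apply Continuous.intervalIntegrable; fun_prop)
    (by apply Continuous.intervalIntegrable; fun_prop) pt
  rw [ftc, intervalIntegral.integral_sub, intervalIntegral.integral_sub,
    intervalIntegral.integral_add, intervalIntegral.integral_const_mul,
    intervalIntegral.integral_const_mul, intervalIntegral.integral_const_mul,
    intervalIntegral.integral_const_mul, ← hD, ← hN, ← hΓ, ← hZ] at mono
  rotate_left
  iterate 6 (apply Continuous.intervalIntegrable; fun_prop)
  have i1 := abs_real_inner_le_norm (q R) (r R)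
  have i2 := abs_real_inner_le_norm (q 0) (r 0)
  have i3 := le_abs_self (inner ℝ (q R) (r R))
  have i4 := neg_abs_le (inner ℝ (q 0) (r 0))
  have hKC : K1 B η = C1 + B/(2*η) := rfl
  have j1 : (1/(2*η)) * Z ≤ B/(2*η) * N := by
    calc (1/(2*η)) * Z ≤ (1/(2*η)) * (B * N) := by gcongr
      _ = _ := by ring
  have j2 : 2 * K1 B η * N ≤ k * η * N := by gcongr
  rw [hKC] at j2
  nlinarith

theorem energy2 {B η R : ℝ} (hη : 0 < η) (hμ : η ≤ μ.im) (hd : FlowDat U u1 u2 u3 B)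
    (h : QSol U u1 u2 u3 μ k g Ψ q r s) (hR : 1 ≤ R) (hk : 0 ≤ k) :
    ‖r 0‖^2 ≤ (‖μ‖ + 1) * √k * (k * (∫ y in (0:ℝ)..R, ‖q y‖^2) + ∫ y in (0:ℝ)..R, ‖r y‖^2)
      + (2 + (9 * B + 1) / η) * ((∫ y in (0:ℝ)..R, ‖r y‖^2) + ∫ y in (0:ℝ)..R, ‖q y‖^2)
      + ∫ y in (0:ℝ)..R, ‖g y‖^2 := by
  have cΨ := h.cΨ
  have cq := h.cq
  have cr := h.cr
  have cs := h.cs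
  have cg := h.cg
  have c3 := hd.c3
  have hB := hd.one_le
  have hB0 : 0 ≤ B := zero_le_one.trans hB
  have hR0 : 0 ≤ R := zero_le_one.trans hR
  have ftc : ∫ y in (0:ℝ)..1, (-1 * inner ℝ (r y) (r y)
        + (1 - y) * (inner ℝ (r y) (s y) + inner ℝ (s y) (r y)))
      = (1 - 1) * inner ℝ (r 1) (r 1) - (1 - 0) * inner ℝ (r 0) (r 0) := by
    refine intervalIntegral.integral_eq_sub_of_hasDerivAt
      (f := fun y => (1 - y) * inner ℝ (r y) (r y))
      (fun y _ => ((hasDerivAt_id y).const_sub 1).mul ((h.dr y).inner ℝ (h.dr y))) ?_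
    apply Continuous.intervalIntegrable; fun_prop
  have mi : ∀ f : ℝ → ℝ, Continuous f → (∀ y, 0 ≤ f y) →
      ∫ y in (0:ℝ)..1, f y ≤ ∫ y in (0:ℝ)..R, f y := by
    intro f hf hf0
    exact intervalIntegral.integral_mono_interval le_rfl zero_le_one hR
      (Eventually.of_forall hf0) (hf.intervalIntegrable _ _)
  have hD := mi (fun y => ‖r y‖^2) (by fun_prop) (fun y => sq_nonneg _)
  have hN := mi (fun y => ‖q y‖^2) (by fun_prop) (fun y => sq_nonneg _)
  have hΓ := mi (fun y => ‖g y‖^2) (by fun_prop) (fun y => sq_nonneg _)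
  have hZ := h.u3psi hd zero_le_one hR
  have hD0 : 0 ≤ ∫ y in (0:ℝ)..1, ‖r y‖^2 :=
    intervalIntegral.integral_nonneg zero_le_one (fun t _ => sq_nonneg _)
  have hN0 : 0 ≤ ∫ y in (0:ℝ)..1, ‖q y‖^2 :=
    intervalIntegral.integral_nonneg zero_le_one (fun t _ => sq_nonneg _)
  set A := (‖μ‖ + 1) * √k with hA
  have hA0 : 0 ≤ A := by positivity
  have pt : ∀ y ∈ Icc (0:ℝ) 1, -(-1 * inner ℝ (r y) (r y)
        + (1 - y) * (inner ℝ (r y) (s y) + inner ℝ (s y) (r y)))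
      ≤ (A + 2 + (9*B+1)/η) * ‖r y‖^2 + (A * k + 3*B/η) * ‖q y‖^2 + ‖g y‖^2
        + (1/η) * ((u3 y)^2 * ‖Ψ y‖^2) := by
    intro y hy
    set T := (3 * u1 y * r y + 3 * u2 y * q y + u3 y * Ψ y) / (μ - U y) with hT
    have hw : ‖T‖ ≤ _ := w_bd hη hμ hd y hy.1 (Ψ y) (q y) (r y)
    have ha : ‖μ - U y‖ ≤ ‖μ‖ + 1 := by
      refine (norm_sub_le _ _).trans ?_
      have := hd.U01 y hy.1
      rw [Complex.norm_real, Real.norm_eq_abs, abs_of_nonneg this.1]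
      linarith
    have hs : ‖s y‖ ≤ k * (‖μ‖ + 1) * ‖q y‖ + ‖g y‖ + ‖T‖ := by
      rw [h.eq y hy.1, ← hT]
      refine (norm_add_le _ _).trans ?_
      gcongr
      refine (norm_sub_le _ _).trans ?_
      gcongr
      simp only [norm_mul, norm_neg, Complex.norm_I, Complex.norm_real, one_mul,
        Real.norm_eq_abs, abs_of_nonneg hk]
      gcongr
    rw [real_inner_self_eq_norm_sq, real_inner_comm (r y) (s y)]
    have i1 := abs_real_inner_le_norm (r y) (s y)
    have i2 : -((1 - y) * (inner ℝ (r y) (s y) + inner ℝ (r y) (s y)))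
        ≤ 2 * (‖r y‖ * ‖s y‖) := by
      have h1 : 0 ≤ 1 - y := by linarith [hy.2]
      have h2 : 1 - y ≤ 1 := by linarith [hy.1]
      have i4 := neg_abs_le (inner ℝ (r y) (s y))
      have i5 := abs_nonneg (inner ℝ (r y) (s y))
      have : -inner ℝ (r y) (s y) ≤ |inner ℝ (r y) (s y)| := by linarith
      nlinarith
    set X := ‖q y‖
    set Y := ‖r y‖
    set P := ‖Ψ y‖
    set G := ‖g y‖
    have hX : 0 ≤ X := norm_nonneg _
    have hY : 0 ≤ Y := norm_nonneg _
    have e1 : Y * ‖s y‖ ≤ Y * (k * (‖μ‖ + 1) * X + G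
        + (3 * B * Y + 3 * B * X + |u3 y| * P) / η) := by
      gcongr
      linarith
    have e2 : 2 * (Y * (k * (‖μ‖ + 1) * X)) ≤ A * Y^2 + A * k * X^2 := by
      have hk' : √k * √k = k := Real.mul_self_sqrt hk
      have : 0 ≤ A * (√k * X - Y)^2 := by positivity
      have e : A * (√k * X - Y)^2 = A * (√k*√k) * X^2 + A * Y^2
        - 2 * (Y * ((√k*√k) * (‖μ‖+1) * X)) := by rw [hA]; ring
      rw [hk'] at e
      linarith
    have e3 : 2 * (Y * ((3 * B * Y + 3 * B * X + |u3 y| * P) / η))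
        ≤ (9*B+1)/η * Y^2 + 3*B/η * X^2 + (1/η) * ((u3 y)^2 * P^2) := by
      have s1 : 0 ≤ (1/η) * (|u3 y| * P - Y)^2 := by positivity
      have s2 : 0 ≤ (3*B/η) * (X - Y)^2 := by positivity
      have s3 : (1/η) * (|u3 y| * P - Y)^2 = (1/η) * ((u3 y)^2 * P^2)
          - 2 * ((1/η) * (|u3 y| * P * Y)) + (1/η) * Y^2 := by
        rw [← sq_abs (u3 y)]; ring
      have s4 : 2 * (Y * ((3 * B * Y + 3 * B * X + |u3 y| * P) / η))
        = 6*B/η * Y^2 + 2 * (3*B/η * X * Y) + 2 * ((1/η) * (|u3 y| * P * Y)) := by ring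
      have s5 : (9*B+1)/η * Y^2 = 6*B/η*Y^2 + 3*B/η * Y^2 + 1/η*Y^2 := by ring
      rw [s4, s5]
      have s6 : (3*B/η) * (X - Y)^2 = 3*B/η * X^2 + 3*B/η * Y^2 - 2 * (3*B/η * X * Y) := by ring
      linarith
    have e4 : Y * (k * (‖μ‖ + 1) * X + G + (3 * B * Y + 3 * B * X + |u3 y| * P) / η)
      = Y * (k * (‖μ‖ + 1) * X) + Y * G
        + Y * ((3 * B * Y + 3 * B * X + |u3 y| * P) / η) := by ring
    have e5 : 2 * (Y * G) ≤ Y^2 + G^2 := by linarith [sq_nonneg (Y - G), sub_sq Y G]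
    have e6 : (A + 2 + (9*B+1)/η) * Y^2 + (A * k + 3*B/η) * X^2
      = (A * Y^2 + A * k * X^2) + ((9*B+1)/η * Y^2 + 3*B/η * X^2) + Y^2 + Y^2 := by ring
    rw [e6]
    rw [e4] at e1
    linarith
  have mono := intervalIntegral.integral_mono_on (μ := volume) zero_le_one
    (f := fun y => -(-1 * inner ℝ (r y) (r y)
        + (1 - y) * (inner ℝ (r y) (s y) + inner ℝ (s y) (r y))))
    (g := fun y => (A + 2 + (9*B+1)/η) * ‖r y‖^2 + (A * k + 3*B/η) * ‖q y‖^2 + ‖g y‖^2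
        + (1/η) * ((u3 y)^2 * ‖Ψ y‖^2))
    (by apply Continuous.intervalIntegrable; fun_prop)
    (by apply Continuous.intervalIntegrable; fun_prop) pt
  rw [intervalIntegral.integral_neg, ftc, intervalIntegral.integral_add,
    intervalIntegral.integral_add,
    intervalIntegral.integral_add, intervalIntegral.integral_const_mul,
    intervalIntegral.integral_const_mul, intervalIntegral.integral_const_mul] at mono
  rotate_left
  iterate 6 (apply Continuous.intervalIntegrable; fun_prop)
  rw [real_inner_self_eq_norm_sq, real_inner_self_eq_norm_sq] at mono
  set D := ∫ y in (0:ℝ)..R, ‖r y‖^2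
  set N := ∫ y in (0:ℝ)..R, ‖q y‖^2
  set Γ := ∫ y in (0:ℝ)..R, ‖g y‖^2
  have j1 : (A + 2 + (9*B+1)/η) * (∫ y in (0:ℝ)..1, ‖r y‖^2) ≤ (A + 2 + (9*B+1)/η) * D := by
    gcongr
  have j2 : (A * k + 3*B/η) * (∫ y in (0:ℝ)..1, ‖q y‖^2) ≤ (A * k + 3*B/η) * N := by gcongr
  have j3 : (1/η) * (∫ y in (0:ℝ)..1, (u3 y)^2 * ‖Ψ y‖^2) ≤ (1/η) * (B * N) := by gcongr
  have hNN : 0 ≤ N := hN0.trans hN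
  have j4 : 3*B/η * N + (1/η) * (B * N) ≤ (2 + (9*B+1)/η) * N := by
    have e : (2 + (9*B+1)/η) * N - (3*B/η * N + (1/η) * (B * N)) = (2 + (5*B+1)/η) * N := by ring
    have : 0 ≤ (2 + (5*B+1)/η) * N := by positivity
    linarith
  have : A * (k * N + D) + (2 + (9*B+1)/η) * (D + N) = A * k * N + A * D
    + (2 + (9*B+1)/η) * D + (2 + (9*B+1)/η) * N := by ring
  have t2 : (A + 2 + (9*B+1)/η) * D = A * D + (2 + (9*B+1)/η) * D := by ring
  have t3 : (A * k + 3*B/η) * N = A * k * N + 3*B/η * N := by ring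
  linarith

set_option maxHeartbeats 4000000 in
/-- Combined bound. -/
theorem energy3 (B η c G : ℝ) (hη : 0 < η) (hc : 0 ≤ c) (hG : 0 ≤ G) (hB : 1 ≤ B) :
    ∃ C : ℝ, 0 < C ∧ ∀ (U u1 u2 u3 : ℝ → ℝ) (μ : ℂ) (k : ℝ) (g Ψ q r s : ℝ → ℂ) (R : ℝ),
      η ≤ μ.im → FlowDat U u1 u2 u3 B → QSol U u1 u2 u3 μ k g Ψ q r s → 1 ≤ R → 1 ≤ k →
      2 * K1 B η ≤ k * η → ‖q 0‖ ≤ c / ‖μ‖ → (∫ y in (0:ℝ)..R, ‖g y‖^2) ≤ G / ‖μ‖^2 →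
      ‖q R‖ * ‖r R‖ ≤ 1 / ‖μ‖ →
      ‖r 0‖ ≤ C * √k ∧ (∫ y in (0:ℝ)..R, ‖r y‖^2) + (∫ y in (0:ℝ)..R, ‖q y‖^2) ≤ C * √k := by
  set C3 := 2 + (9 * B + 1) / η with hC3
  have hC30 : 0 ≤ C3 := by positivity
  set C4 := 1 + 1/η + C3/η with hC4
  set C5 := 1 + 1/η with hC5
  set P := C4*C5*(2+2*c+G/η)+G/η^2+1 with hP
  have hP1 : 1 ≤ P := by
    have : 0 ≤ C4*C5*(2+2*c+G/η)+G/η^2 := by positivity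
    linarith
  refine ⟨2*P + C5 * (2/η + 2*c*(2*P)/η + G/η^2), by positivity, ?_⟩
  intro U u1 u2 u3 μ k g Ψ q r s R hμ hd h hR hk hkK hq0 hg hbd
  have E1 := h.energy1 hη hμ hd (zero_le_one.trans hR) (zero_le_one.trans hk) hkK
  have E2 := h.energy2 hη hμ hd hR (zero_le_one.trans hk)
  set D := ∫ y in (0:ℝ)..R, ‖r y‖^2
  set N := ∫ y in (0:ℝ)..R, ‖q y‖^2
  set Γ := ∫ y in (0:ℝ)..R, ‖g y‖^2
  have hR0 := zero_le_one.trans hR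
  have hN0 : 0 ≤ N := intervalIntegral.integral_nonneg hR0 (fun t _ => sq_nonneg _)
  have hD0 : 0 ≤ D := intervalIntegral.integral_nonneg hR0 (fun t _ => sq_nonneg _)
  have hm : η ≤ ‖μ‖ := hμ.trans ((le_abs_self _).trans (Complex.abs_im_le_norm μ))
  set m := ‖μ‖
  set ρ := ‖r 0‖
  set κ := √k with hκ
  have hρ : 0 ≤ ρ := norm_nonneg _
  have hm0 : 0 < m := hη.trans_le hm
  have hκ1 : 1 ≤ κ := Real.one_le_sqrt.2 hk
  have hNk : N ≤ k * N := le_mul_of_one_le_left hN0 hk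
  have hq0' : ‖q 0‖ * ρ ≤ c * ρ / m := by
    calc _ ≤ c / m * ρ := by gcongr
      _ = _ := by ring
  clear_value D N Γ m ρ κ
  set W := k * N + D with hW
  have hE : D + k * η * N ≤ 2 * (1/m + c*ρ/m) + G/m^2 := by linarith
  have hW0 : 0 ≤ W := by positivity
  have hWE : W ≤ C5 * (D + k * η * N) := by
    have : C5 * (D + k * η * N) - W = D/η + k * η * N := by
      rw [hC5, hW]; field_simp; ring
    have : 0 ≤ D/η + k * η * N := by positivity
    linarith
  have hWm : m * W ≤ C5 * (2 + 2 * c * ρ + G/η) := by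
    have hC50 : 0 ≤ C5 := by positivity
    have h1 : W ≤ C5 * (2 * (1/m + c*ρ/m) + G/m^2) := hWE.trans (by gcongr)
    have h2 : m * W ≤ m * (C5 * (2 * (1/m + c*ρ/m) + G/m^2)) := by gcongr
    have h3 : m * (C5 * (2 * (1/m + c*ρ/m) + G/m^2)) = C5 * (2 + 2*c*ρ + G/m) := by
      field_simp
    have h4 : G/m ≤ G/η := by gcongr
    rw [h3] at h2
    refine h2.trans ?_
    gcongr
  have hρ2 : ρ^2 ≤ C4 * κ * (m * W) + G/η^2 := by
    have h1 : C3 * (D + N) ≤ C3 * W := by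
      gcongr; linarith
    have h2 : G/m^2 ≤ G/η^2 := by gcongr
    have h3 : (m+1)*κ*W + C3 * W ≤ C4 * κ * (m*W) := by
      have : C4 * κ * (m*W) - ((m+1)*κ*W + C3 * W)
        = ((m/η - 1) * κ + C3 * (m/η * κ - 1)) * W := by rw [hC4]; ring
      have h5 : 1 ≤ m/η := by rwa [one_le_div hη]
      have h6 : 1 ≤ m/η*κ := by nlinarith
      have : 0 ≤ ((m/η - 1) * κ + C3 * (m/η * κ - 1)) * W := by
        apply mul_nonneg _ hW0
        have : 0 ≤ m/η - 1 := by linarith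
        have : 0 ≤ m/η*κ - 1 := by linarith
        positivity
      linarith
    linarith
  have hρ3 : ρ^2 ≤ P * κ * (1 + ρ) := by
    have h1 : C4 * κ * (m * W) ≤ C4 * κ * (C5 * (2 + 2 * c * ρ + G/η)) := by gcongr
    have h2 : 2 + 2 * c * ρ + G/η ≤ (2 + 2*c + G/η) * (1+ρ) := by
      have : 0 ≤ G/η := by positivity
      nlinarith [mul_nonneg this hρ]
    have h3 : C4 * κ * (C5 * (2 + 2 * c * ρ + G/η))
        ≤ C4 * κ * (C5 * ((2 + 2*c + G/η) * (1+ρ))) := by gcongr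
    have h4 : G/η^2 ≤ G/η^2 * (κ * (1+ρ)) := by
      apply le_mul_of_one_le_right (by positivity)
      nlinarith
    have h5 : P * κ * (1 + ρ) = C4 * κ * (C5 * ((2 + 2*c + G/η) * (1+ρ)))
      + G/η^2 * (κ * (1+ρ)) + κ * (1+ρ) := by rw [hP]; ring
    have : 0 ≤ κ * (1+ρ) := by positivity
    linarith
  have hρ4 : ρ ≤ 2 * P * κ := by
    by_contra! hcon
    have h1 : 1 ≤ P * κ := by nlinarith
    nlinarith
  have hfin : D + N ≤ C5 * (2/η + 2*c*(2*P)/η + G/η^2) * κ := by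
    have h1 : W ≤ C5 * (2 * (1/m + c*ρ/m) + G/m^2) := hWE.trans (by gcongr)
    have h2 : 2 * (1/m + c*ρ/m) + G/m^2 ≤ 2 * (1/η + c*(2*P*κ)/η) + G/η^2 := by gcongr
    have h3 : 2 * (1/η + c*(2*P*κ)/η) + G/η^2 ≤ (2/η + 2*c*(2*P)/η + G/η^2) * κ := by
      have e : (2/η + 2*c*(2*P)/η + G/η^2) * κ - (2 * (1/η + c*(2*P*κ)/η) + G/η^2)
        = (2/η + G/η^2) * (κ - 1) := by ring
      have : 0 ≤ (2/η + G/η^2) * (κ - 1) := by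
        have : 0 ≤ κ - 1 := by linarith
        positivity
      linarith
    have h4 : D + N ≤ W := by linarith
    calc D + N ≤ C5 * (2 * (1/m + c*ρ/m) + G/m^2) := h4.trans h1
      _ ≤ C5 * ((2/η + 2*c*(2*P)/η + G/η^2) * κ) := by gcongr; exact h2.trans h3
      _ = _ := by ring
  constructor
  · have : 0 ≤ C5 * (2/η + 2*c*(2*P)/η + G/η^2) * κ := by positivity
    nlinarith
  · have : 0 ≤ 2 * P * κ := by positivity
    nlinarith

def rest (U u1 u2 u3 : ℝ → ℝ) (μ : ℂ) (g Ψ q r : ℝ → ℂ) (y : ℝ) : ℂ :=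
  - r y * u1 y / (μ - U y)^2 + g y / (μ - U y)
    - (3 * u1 y * r y + 3 * u2 y * q y + u3 y * Ψ y) / (μ - U y) / (μ - U y)

theorem a_ne {η : ℝ} (hη : 0 < η) (hμ : η ≤ μ.im) (y : ℝ) : μ - U y ≠ 0 := by
  rw [← norm_pos_iff]; exact hη.trans_le (a_low hμ y)

theorem c_rest {B η : ℝ} (hη : 0 < η) (hμ : η ≤ μ.im) (hd : FlowDat U u1 u2 u3 B)
    (h : QSol U u1 u2 u3 μ k g Ψ q r s) : Continuous (rest U u1 u2 u3 μ g Ψ q r) := by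
  have cΨ := h.cΨ
  have cq := h.cq
  have cr := h.cr
  have cg := h.cg
  have c3 := hd.c3
  have c1 := hd.c1
  have c2 := hd.c2
  have cU := hd.cU
  have ha := a_ne (U := U) hη hμ
  have ha2 : ∀ y, (μ - U y)^2 ≠ 0 := fun y => pow_ne_zero 2 (ha y)
  unfold rest
  fun_prop (disch := assumption)

theorem repr {B η R : ℝ} (hη : 0 < η) (hμ : η ≤ μ.im) (hd : FlowDat U u1 u2 u3 B)
    (h : QSol U u1 u2 u3 μ k g Ψ q r s) (hR : 0 ≤ R) :
    -Complex.I * k * Ψ R = r R / (μ - U R) - r 0 / (μ - U 0)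
      + ∫ y in (0:ℝ)..R, rest U u1 u2 u3 μ g Ψ q r y := by
  have ha := a_ne (U := U) hη hμ
  have cq := h.cq
  have crest := c_rest hη hμ hd h
  have e1 : Ψ R = ∫ t in (0:ℝ)..R, q t := by
    rw [intervalIntegral.integral_eq_sub_of_hasDerivAt (fun x _ => h.dΨ x)
      (cq.intervalIntegrable _ _), h.z, sub_zero]
  have hder : ∀ y, HasDerivAt (fun y => r y / (μ - U y))
      ((s y * (μ - U y) - r y * (-(u1 y : ℂ))) / (μ - U y)^2) y := by
    intro y
    exact (h.dr y).div (((hd.d0 y).ofReal_comp).const_sub μ) (ha y)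
  have cs := h.cs
  have cr := h.cr
  have c1 := hd.c1
  have cU := hd.cU
  have ha2 : ∀ y, (μ - U y)^2 ≠ 0 := fun y => pow_ne_zero 2 (ha y)
  have ftc := intervalIntegral.integral_eq_sub_of_hasDerivAt (a := 0) (b := R)
    (fun y _ => hder y) (by
      apply Continuous.intervalIntegrable
      fun_prop (disch := assumption))
  rw [e1, ← intervalIntegral.integral_const_mul, ← ftc, ← intervalIntegral.integral_add]
  · apply intervalIntegral.integral_congr
    intro y hy
    rw [uIcc_of_le hR] at hy
    have := ha y
    simp only [rest]
    rw [h.eq y hy.1]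
    field_simp
    ring
  · apply Continuous.intervalIntegrable
    fun_prop (disch := assumption)
  · exact crest.intervalIntegrable _ _

theorem rest_bd {B η R : ℝ} (hη : 0 < η) (hμ : η ≤ μ.im) (hd : FlowDat U u1 u2 u3 B)
    (h : QSol U u1 u2 u3 μ k g Ψ q r s) (hR : 0 ≤ R) {w : ℂ} {A : ℝ}
    (hw : ∀ y, 0 ≤ y → ‖w / (μ - U y)‖ ≤ A) :
    ∫ y in (0:ℝ)..R, ‖w * rest U u1 u2 u3 μ g Ψ q r y‖ ≤
      A * ((5 * B + 2 * (∫ y in (0:ℝ)..R, ‖r y‖^2) + (2 + B) * ∫ y in (0:ℝ)..R, ‖q y‖^2) / η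
        + ∫ y in (0:ℝ)..R, ‖g y‖) := by
  have cΨ := h.cΨ
  have cq := h.cq
  have cr := h.cr
  have cg := h.cg
  have c3 := hd.c3
  have c1 := hd.c1
  have c2 := hd.c2
  have crest := c_rest hη hμ hd h
  have hA0 : 0 ≤ A := (norm_nonneg _).trans (hw 0 le_rfl)
  set D := ∫ y in (0:ℝ)..R, ‖r y‖^2 with hD
  set N := ∫ y in (0:ℝ)..R, ‖q y‖^2 with hN
  have hN0 : 0 ≤ N := intervalIntegral.integral_nonneg hR (fun t _ => sq_nonneg _)
  have pt : ∀ y ∈ Icc 0 R, ‖w * rest U u1 u2 u3 μ g Ψ q r y‖ ≤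
      A * ((1/η) * (4 * ((1 + y) * (|u1 y| + |u2 y| + |u3 y|))^2 + 2 * ‖r y‖^2 + 2 * ‖q y‖^2
        + (1 + N) * ((1 + y) * (|u1 y| + |u2 y| + |u3 y|))) + ‖g y‖) := by
    intro y hy
    have hal := a_low (U := U) hμ y
    have hane := a_ne (U := U) hη hμ y
    have e0 : w * rest U u1 u2 u3 μ g Ψ q r y = w / (μ - U y) *
      (- r y * u1 y / (μ - U y) + g y
        - (3 * u1 y * r y + 3 * u2 y * q y + u3 y * Ψ y) / (μ - U y)) := by
      simp only [rest]; field_simp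
    rw [e0, norm_mul]
    apply mul_le_mul (hw y hy.1) _ (norm_nonneg _) hA0
    set M := (1 + y) * (|u1 y| + |u2 y| + |u3 y|) with hM
    have y0 := hy.1
    have p1 := abs_nonneg (u1 y)
    have p2 := abs_nonneg (u2 y)
    have p3 := abs_nonneg (u3 y)
    have hM0 : 0 ≤ M := by positivity
    have hMs : |u1 y| + |u2 y| + |u3 y| ≤ M := le_mul_of_one_le_left (by positivity) (by linarith)
    have hP : ‖Ψ y‖ ≤ (1 + y) * (1 + N) := by
      have p := h.psi_sq' y0 hy.2
      apply abs_le_of_sq_le_sq' _ (by positivity) |>.2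
      refine p.trans ?_
      rw [mul_pow]
      have : y ≤ (1+y)^2 := by nlinarith
      have : N ≤ (1+N)^2 := by nlinarith
      gcongr
    have n1 : ‖- r y * u1 y / (μ - U y)‖ ≤ (1/η) * (‖r y‖ * |u1 y|) := by
      rw [norm_div, norm_mul, norm_neg, Complex.norm_real, Real.norm_eq_abs, one_div_mul_eq_div]
      gcongr
    have n2 : ‖(3 * u1 y * r y + 3 * u2 y * q y + u3 y * Ψ y) / (μ - U y)‖
        ≤ (1/η) * (3 * |u1 y| * ‖r y‖ + 3 * |u2 y| * ‖q y‖ + |u3 y| * ‖Ψ y‖) := by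
      rw [norm_div, one_div_mul_eq_div]
      gcongr
      refine (norm_add₃_le).trans ?_
      simp [Complex.norm_real, Real.norm_eq_abs]
    have n3 : ‖r y‖ * |u1 y| * 4 ≤ 2 * M^2 + 2 * ‖r y‖^2 := by
      have : ‖r y‖ * |u1 y| ≤ ‖r y‖ * M := by gcongr; linarith
      nlinarith [sq_nonneg (M - ‖r y‖)]
    have n4 : 3 * |u2 y| * ‖q y‖ ≤ 2 * M^2 + 2 * ‖q y‖^2 := by
      have : |u2 y| * ‖q y‖ ≤ M * ‖q y‖ := by gcongr; linarith
      nlinarith [sq_nonneg (M - ‖q y‖), sq_nonneg M, sq_nonneg ‖q y‖]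
    have n5 : |u3 y| * ‖Ψ y‖ ≤ (1+N) * M := by
      calc |u3 y| * ‖Ψ y‖ ≤ |u3 y| * ((1 + y) * (1 + N)) := by gcongr
        _ = (1+N) * ((1+y) * |u3 y|) := by ring
        _ ≤ (1+N) * M := by rw [hM]; gcongr; linarith
    have n6 : (1/η) * (‖r y‖ * |u1 y|) + (1/η) * (3 * |u1 y| * ‖r y‖ + 3 * |u2 y| * ‖q y‖
        + |u3 y| * ‖Ψ y‖) ≤ (1/η) * (4 * M^2 + 2 * ‖r y‖^2 + 2 * ‖q y‖^2 + (1 + N) * M) := by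
      rw [← mul_add]
      apply mul_le_mul_of_nonneg_left _ (by positivity)
      linarith
    have n7 := norm_sub_le (- r y * u1 y / (μ - U y) + g y)
        ((3 * u1 y * r y + 3 * u2 y * q y + u3 y * Ψ y) / (μ - U y))
    have n8 := norm_add_le (- r y * u1 y / (μ - U y)) (g y)
    linarith
  have mono := intervalIntegral.integral_mono_on (μ := volume) hR
    (f := fun y => ‖w * rest U u1 u2 u3 μ g Ψ q r y‖)
    (g := fun y => A * ((1/η) * (4 * ((1 + y) * (|u1 y| + |u2 y| + |u3 y|))^2 + 2 * ‖r y‖^2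
        + 2 * ‖q y‖^2 + (1 + N) * ((1 + y) * (|u1 y| + |u2 y| + |u3 y|))) + ‖g y‖))
    (by apply Continuous.intervalIntegrable; fun_prop)
    (by apply Continuous.intervalIntegrable; fun_prop) pt
  refine mono.trans ?_
  rw [intervalIntegral.integral_const_mul, intervalIntegral.integral_add,
    intervalIntegral.integral_const_mul, intervalIntegral.integral_add,
    intervalIntegral.integral_add, intervalIntegral.integral_add,
    intervalIntegral.integral_const_mul, intervalIntegral.integral_const_mul,
    intervalIntegral.integral_const_mul, intervalIntegral.integral_const_mul, ← hD, ← hN]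
  rotate_left
  iterate 8 (apply Continuous.intervalIntegrable; fun_prop)
  apply mul_le_mul_of_nonneg_left _ hA0
  apply add_le_add _ le_rfl
  rw [one_div_mul_eq_div]
  apply div_le_div_of_nonneg_right _ hη.le
  have := hd.I1 R hR
  have := hd.I2 R hR
  have : (1+N) * (∫ y in (0:ℝ)..R, (1 + y) * (|u1 y| + |u2 y| + |u3 y|)) ≤ (1+N) * B := by gcongr
  nlinarith

/-- Final a priori bound. -/
theorem final_bd (B η c G : ℝ) (hη : 0 < η) (hc : 0 ≤ c) (hG : 0 ≤ G) (hB : 1 ≤ B) :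
    ∃ C : ℝ, 0 < C ∧ ∀ (U u1 u2 u3 : ℝ → ℝ) (μ : ℂ) (k : ℝ) (g Ψ q r s : ℝ → ℂ) (R : ℝ),
      η ≤ μ.im → FlowDat U u1 u2 u3 B → QSol U u1 u2 u3 μ k g Ψ q r s → 1 ≤ R → 1 ≤ k →
      2 * K1 B η ≤ k * η → ‖q 0‖ ≤ c / ‖μ‖ → (∫ y in (0:ℝ)..R, ‖g y‖^2) ≤ G / ‖μ‖^2 →
      (∫ y in (0:ℝ)..R, ‖g y‖) ≤ G → ‖r R‖ ≤ 1 →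
      ‖q R‖ * ‖r R‖ ≤ 1 / ‖μ‖ →
      ‖(μ - 1) * Ψ R‖ ≤ C * k ^ (-(1:ℝ)/2) := by
  obtain ⟨C, hC, H⟩ := energy3 B η c G hη hc hG hB
  refine ⟨(1 + 1/η) * (1 + C + ((5 * B + 2 * C + (2 + B) * C)/η + G)), by positivity, ?_⟩
  intro U u1 u2 u3 μ k g Ψ q r s R hμ hd h hR hk hkK hq0 hg hg1 hr hbd
  obtain ⟨H1, H2⟩ := H U u1 u2 u3 μ k g Ψ q r s R hμ hd h hR hk hkK hq0 hg hbd
  have hR0 := zero_le_one.trans hR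
  have hw : ∀ y, 0 ≤ y → ‖(μ - 1) / (μ - U y)‖ ≤ 1 + 1/η := by
    intro y hy
    have hal := a_low (U := U) hμ y
    have := hd.U01 y hy
    have hpos := hη.trans_le hal
    rw [norm_div, div_le_iff₀ hpos]
    have e : μ - 1 = (μ - U y) + ((U y - 1 : ℝ) : ℂ) := by push_cast; ring
    have e2 : ‖((U y - 1 : ℝ) : ℂ)‖ ≤ 1 := by
      rw [Complex.norm_real, Real.norm_eq_abs, abs_le]; constructor <;> linarith
    have e3 : ‖μ - 1‖ ≤ ‖μ - U y‖ + 1 := by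
      rw [e]; exact (norm_add_le _ _).trans (by gcongr)
    have e4 : 1 ≤ 1/η * ‖μ - U y‖ := by
      rw [one_div_mul_eq_div, one_le_div hη]; exact hal
    linarith
  have R1 := h.repr hη hμ hd hR0
  have R2 := h.rest_bd hη hμ hd hR0 hw
  set D := ∫ y in (0:ℝ)..R, ‖r y‖^2 with hD
  set N := ∫ y in (0:ℝ)..R, ‖q y‖^2 with hN
  have hN0 : 0 ≤ N := intervalIntegral.integral_nonneg hR0 (fun t _ => sq_nonneg _)
  have hD0 : 0 ≤ D := intervalIntegral.integral_nonneg hR0 (fun t _ => sq_nonneg _)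
  have hκ1 : 1 ≤ √k := Real.one_le_sqrt.2 hk
  have hk0 : 0 < k := zero_lt_one.trans_le hk
  have e1 : -Complex.I * k * ((μ - 1) * Ψ R) = (μ - 1) / (μ - U R) * r R
      - (μ - 1) / (μ - U 0) * r 0 + ∫ y in (0:ℝ)..R, (μ - 1) * rest U u1 u2 u3 μ g Ψ q r y := by
    rw [intervalIntegral.integral_const_mul,
      show -Complex.I * k * ((μ - 1) * Ψ R) = (μ - 1) * (-Complex.I * k * Ψ R) by ring, R1]
    ring
  have e2 : ‖-Complex.I * k * ((μ - 1) * Ψ R)‖ = k * ‖(μ - 1) * Ψ R‖ := by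
    rw [norm_mul, norm_mul, norm_neg, Complex.norm_I, one_mul, Complex.norm_real,
      Real.norm_eq_abs, abs_of_pos hk0]
  have e3 : k * ‖(μ - 1) * Ψ R‖ ≤ (1 + 1/η) * 1 + (1 + 1/η) * (C * √k)
      + (1 + 1/η) * ((5 * B + 2 * D + (2 + B) * N) / η + G) := by
    rw [← e2, e1]
    refine (norm_add_le _ _).trans ?_
    apply add_le_add
    · refine (norm_sub_le _ _).trans ?_
      rw [norm_mul, norm_mul]
      gcongr
      · exact hw R hR0
      · exact hw 0 le_rfl
    · refine (intervalIntegral.norm_integral_le_integral_norm hR0).trans (R2.trans ?_)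
      gcongr
  have hDκ : D ≤ C * √k := by linarith
  have hNκ : N ≤ C * √k := by linarith
  have e4 : (5 * B + 2 * D + (2 + B) * N) / η + G
      ≤ ((5 * B + 2 * C + (2 + B) * C)/η + G) * √k := by
    have : 5 * B + 2 * D + (2 + B) * N ≤ (5 * B + 2 * C + (2 + B) * C) * √k := by
      have a : (2 + B) * N ≤ (2 + B) * (C * √k) := by gcongr
      nlinarith
    have a2 : (5 * B + 2 * D + (2 + B) * N)/η ≤ ((5 * B + 2 * C + (2 + B) * C) * √k)/η := by gcongr
    have a3 : G ≤ G * √k := le_mul_of_one_le_right hG hκ1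
    calc _ ≤ ((5 * B + 2 * C + (2 + B) * C) * √k)/η + G * √k := add_le_add a2 a3
      _ = _ := by ring
  have e5 : k * ‖(μ - 1) * Ψ R‖
      ≤ (1 + 1/η) * (1 + C + ((5 * B + 2 * C + (2 + B) * C)/η + G)) * √k := by
    refine e3.trans ?_
    have : (1 + 1/η) * ((5 * B + 2 * D + (2 + B) * N) / η + G)
      ≤ (1 + 1/η) * (((5 * B + 2 * C + (2 + B) * C)/η + G) * √k) := by gcongr
    have : (1 + 1/η) * 1 ≤ (1 + 1/η) * √k := by gcongr
    nlinarith
  have e6 : k ^ (-(1:ℝ)/2) = √k / k := by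
    rw [show -(1:ℝ)/2 = 1/2 - 1 by norm_num, Real.rpow_sub_one hk0.ne', ← Real.sqrt_eq_rpow]
  rw [e6, ← mul_div_assoc, le_div_iff₀ hk0]
  linarith
end QSol
end
end

section
open MeasureTheory Filter Set
noncomputable section

def dyson {E : Type*} [NormedAddCommGroup E] [NormedSpace ℝ E]
    (A : ℝ → E →L[ℝ] E) (b : ℝ → E) (x0 : E) : ℕ → ℝ → E
  | 0 => fun t => x0 + ∫ s in (0:ℝ)..t, b s
  | (n+1) => fun t => ∫ s in (0:ℝ)..t, A s (dyson A b x0 n s)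

theorem linear_ode {E : Type*} [NormedAddCommGroup E] [NormedSpace ℝ E] [CompleteSpace E]
    (A : ℝ → E →L[ℝ] E) (hA : Continuous A) (b : ℝ → E) (hb : Continuous b) (x0 : E) :
    ∃ x : ℝ → E, x 0 = x0 ∧ ∀ t, HasDerivAt x (A t (x t) + b t) t := by
  set u := dyson A b x0 with hu
  have hcont : ∀ n, Continuous (u n) := by
    intro n
    induction n with
    | zero =>
      show Continuous (fun t => x0 + ∫ s in (0:ℝ)..t, b s)
      exact continuous_const.add (intervalIntegral.continuous_primitive
        (fun a c => hb.intervalIntegrable a c) 0)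
    | succ n ih =>
      show Continuous (fun t => ∫ s in (0:ℝ)..t, A s (u n s))
      exact intervalIntegral.continuous_primitive
        (fun a c => (hA.clm_apply ih).intervalIntegrable a c) 0
  have hd0 : ∀ t, HasDerivAt (u 0) (b t) t := by
    intro t
    have h := (hb.integral_hasStrictDerivAt 0 t).hasDerivAt
    exact h.const_add x0
  have hds : ∀ n t, HasDerivAt (u (n+1)) (A t (u n t)) t := by
    intro n t
    exact ((hA.clm_apply (hcont n)).integral_hasStrictDerivAt 0 t).hasDerivAt
  have hu00 : u 0 0 = x0 := by simp [hu, dyson]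
  have hus0 : ∀ n, u (n+1) 0 = 0 := by intro n; simp [hu, dyson]
  have hsum0 : Summable (fun n => u n 0) := by
    rw [← summable_nat_add_iff 1]; simp [hus0, summable_zero]
  refine ⟨fun t => ∑' n, u n t, ?_, ?_⟩
  · show ∑' n, u n 0 = x0
    rw [hsum0.tsum_eq_zero_add, hu00]; simp [hus0]
  intro t
  -- bounds on [-T, T]
  set T : ℝ := |t| + 1 with hT
  have hTpos : 0 < T := by positivity
  obtain ⟨K, hK⟩ := (isCompact_Icc (a := -T) (b := T)).exists_bound_of_continuousOn hA.continuousOn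
  obtain ⟨M, hM⟩ := (isCompact_Icc (a := -T) (b := T)).exists_bound_of_continuousOn
    (hcont 0).continuousOn
  obtain ⟨M', hM'⟩ := (isCompact_Icc (a := -T) (b := T)).exists_bound_of_continuousOn
    hb.continuousOn
  have h0T : (0:ℝ) ∈ Icc (-T) T := ⟨by linarith, by linarith⟩
  have hK0 : 0 ≤ K := (norm_nonneg _).trans (hK 0 h0T)
  have hM0 : 0 ≤ M := (norm_nonneg _).trans (hM 0 h0T)
  have hbd : ∀ n, ∀ s ∈ Icc (-T) T, ‖u n s‖ ≤ M * (K * |s|)^n / n.factorial := by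
    intro n
    induction n with
    | zero => intro s hs; simpa using hM s hs
    | succ n ih =>
      intro s hs
      have h1 : ∀ r ∈ uIoc 0 s, ‖A r (u n r)‖ ≤ M * K^(n+1) / n.factorial * |r - 0|^n := by
        intro r hr
        have hr' : r ∈ Icc (-T) T := by
          have : r ∈ uIcc 0 s := uIoc_subset_uIcc hr
          exact (uIcc_subset_Icc h0T hs) this
        calc ‖A r (u n r)‖ ≤ ‖A r‖ * ‖u n r‖ := (A r).le_opNorm _
          _ ≤ K * (M * (K * |r|)^n / n.factorial) := by
              gcongr
              · exact hK r hr'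
              · exact ih r hr'
          _ = _ := by rw [sub_zero, mul_pow, pow_succ]; ring
      have h2 : ‖u (n+1) s‖ ≤ ∫ r in uIoc 0 s, M * K^(n+1) / n.factorial * |r - 0|^n := by
        show ‖∫ r in (0:ℝ)..s, A r (u n r)‖ ≤ _
        rw [intervalIntegral.norm_intervalIntegral_eq]
        apply norm_integral_le_of_norm_le
        · have : Continuous (fun r : ℝ => M * K^(n+1) / n.factorial * |r - 0|^n) := by fun_prop
          exact (this.intervalIntegrable 0 s).def'
        · exact (ae_restrict_mem measurableSet_uIoc).mono h1
      refine h2.trans (le_of_eq ?_)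
      rw [integral_const_mul, integral_pow_abs_sub_uIoc, sub_zero, mul_pow, Nat.factorial_succ]
      push_cast
      field_simp
  have htT : t ∈ Ioo (-T) T := by
    constructor
    · have := neg_abs_le t; linarith
    · have := le_abs_self t; linarith
  set g' : ℕ → ℝ → E := fun n => match n with
    | 0 => b
    | (m+1) => fun s => A s (u m s) with hg'
  have hsumu : Summable (fun n : ℕ => M * (K * T)^n / n.factorial) := by
    have := (Real.summable_pow_div_factorial (K*T)).mul_left M
    simpa [mul_div_assoc] using this
  have hsum : ∀ s ∈ Icc (-T) T, Summable (fun n => u n s) := by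
    intro s hs
    refine Summable.of_norm_bounded hsumu (fun n => (hbd n s hs).trans ?_)
    have : |s| ≤ T := abs_le.2 hs
    gcongr
  have key := hasDerivAt_tsum_of_isPreconnected (g := u) (g' := g')
    (u := fun n => match n with
      | 0 => M'
      | (m+1) => K * (M * (K * T)^m / m.factorial)) (t := Ioo (-T) T) (y₀ := 0) (y := t)
    (by rw [← summable_nat_add_iff 1]; exact hsumu.mul_left K) isOpen_Ioo isPreconnected_Ioo
    (by
      intro n y _
      cases n with
      | zero => exact hd0 y
      | succ m => exact hds m y)
    (by
      intro n y hy
      have hy' := Ioo_subset_Icc_self hy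
      cases n with
      | zero => exact hM' y hy'
      | succ m =>
        have : |y| ≤ T := abs_le.2 hy'
        calc ‖A y (u m y)‖ ≤ ‖A y‖ * ‖u m y‖ := (A y).le_opNorm _
          _ ≤ K * (M * (K * |y|)^m / m.factorial) := by
              gcongr
              · exact hK y hy'
              · exact hbd m y hy'
          _ ≤ K * (M * (K * T)^m / m.factorial) := by gcongr)
    ⟨by linarith, by linarith⟩ hsum0 htT
  convert key using 1
  have hs := hsum t (Ioo_subset_Icc_self htT)
  have hs1 : Summable (fun n => g' n t) := by
    rw [← summable_nat_add_iff 1]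
    exact (A t).summable hs
  rw [hs1.tsum_eq_zero_add, add_comm, (A t).map_tsum hs]
end
end

section
open MeasureTheory Filter Set
noncomputable section

theorem interval_le_Ioi {f : ℝ → ℝ} (hf : IntegrableOn f (Ioi 0)) (h0 : ∀ y, 0 < y → 0 ≤ f y)
    {R : ℝ} (hR : 0 ≤ R) : ∫ y in (0:ℝ)..R, f y ≤ ∫ y in Ioi (0:ℝ), f y := by
  rw [intervalIntegral.integral_of_le hR]
  apply setIntegral_mono_set hf
  · filter_upwards [ae_restrict_mem measurableSet_Ioi] with y hy using h0 y hy
  · exact (Ioc_subset_Ioi_self).eventuallyLE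

theorem wt_int {f ω : ℝ → ℝ} (hω : WeightFn ω) (hf : Continuous f)
    (h : IntegrableOn (fun y => (f y)^2 * ω y) (Ioi (0:ℝ))) :
    IntegrableOn f (Ioi (0:ℝ)) ∧ IntegrableOn (fun y => (f y)^2) (Ioi (0:ℝ)) := by
  constructor
  · apply Integrable.mono' (h.add hω.integrable_inv) hf.aestronglyMeasurable
    filter_upwards [ae_restrict_mem measurableSet_Ioi] with y hy
    have w := hω.pos y (le_of_lt hy)
    rw [Real.norm_eq_abs]
    simp only [Pi.add_apply]
    have : 0 ≤ (|f y| * ω y - 1)^2 := sq_nonneg _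
    have e : (f y)^2 * ω y + 1 / ω y = (((|f y| * ω y)^2) + 1) / ω y := by
      rw [mul_pow, sq_abs]; field_simp
    rw [e, le_div_iff₀ w]
    nlinarith [sq_nonneg (|f y| * ω y)]
  · apply Integrable.mono' h (by fun_prop)
    filter_upwards [ae_restrict_mem measurableSet_Ioi] with y hy
    have w := hω.one_le y (le_of_lt hy)
    rw [Real.norm_eq_abs, abs_of_nonneg (sq_nonneg _)]
    exact le_mul_of_one_le_right (sq_nonneg _) w

structure FlowLim (U u1 u2 : ℝ → ℝ) : Prop where
  t0 : Tendsto U atTop (nhds 1)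
  t1 : Tendsto u1 atTop (nhds 0)
  t2 : Tendsto u2 atTop (nhds 0)
  ty2 : Tendsto (fun y => y * u2 y) atTop (nhds 0)
  tF : Tendsto (fun y => 1 - U y + y * u1 y) atTop (nhds 0)
  iF : IntegrableOn (fun y => 1 - U y + y * u1 y) (Ioi 0)

theorem flow_exists {U ω : ℝ → ℝ}
    (hU : AdmissibleShearFlow U) (hω : WeightFn ω) (hdec : WeightedDecay U ω) :
    (∃ B, FlowDat U (deriv U) (iteratedDeriv 2 U) (iteratedDeriv 3 U) B) ∧
      FlowLim U (deriv U) (iteratedDeriv 2 U) := by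
  have sm : ∀ n : ℕ, Differentiable ℝ (iteratedDeriv n U) := fun n =>
    hU.smooth.differentiable_iteratedDeriv n (by exact_mod_cast ENat.natCast_lt_top n)
  have dd : ∀ n : ℕ, ∀ y, HasDerivAt (iteratedDeriv n U) (iteratedDeriv (n+1) U y) y := by
    intro n y
    rw [iteratedDeriv_succ]
    exact (sm n y).hasDerivAt
  have d0 : ∀ y, HasDerivAt U (deriv U y) y := by
    intro y
    simpa [iteratedDeriv_zero, iteratedDeriv_one] using dd 0 y
  have d1 : ∀ y, HasDerivAt (deriv U) (iteratedDeriv 2 U y) y := by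
    intro y
    simpa [iteratedDeriv_one] using dd 1 y
  have d2 := dd 2
  obtain ⟨M1, hM1⟩ := hU.derivs_bounded 1 le_rfl (by norm_num)
  obtain ⟨M2, hM2⟩ := hU.derivs_bounded 2 (by norm_num) (by norm_num)
  obtain ⟨M3, hM3⟩ := hU.derivs_bounded 3 (by norm_num) (by norm_num)
  have c3 : Continuous (iteratedDeriv 3 U) := (sm 3).continuous
  have c2 : Continuous (iteratedDeriv 2 U) := (sm 2).continuous
  have c1 : Continuous (deriv U) := by simpa [iteratedDeriv_one] using (sm 1).continuous
  have cU : Continuous U := by simpa using (sm 0).continuous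
  have w1 := hdec.2 1 le_rfl (by norm_num)
  have w2 := hdec.2 2 (by norm_num) (by norm_num)
  have w3 := hdec.2 3 (by norm_num) (by norm_num)
  simp only [iteratedDeriv_one] at w1 hM1
  set u1 := deriv U with hu1
  set u2 := iteratedDeriv 2 U with hu2
  set u3 := iteratedDeriv 3 U with hu3
  obtain ⟨i1, j1⟩ := wt_int hω (f := fun y => (1 + y) * u1 y) (by fun_prop) w1
  obtain ⟨i2, j2⟩ := wt_int hω (f := fun y => (1 + y) * u2 y) (by fun_prop) w2
  obtain ⟨i3, j3⟩ := wt_int hω (f := fun y => (1 + y) * u3 y) (by fun_prop) w3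
  have kk : ∀ f : ℝ → ℝ, Continuous f → IntegrableOn (fun y => (1 + y) * f y) (Ioi (0:ℝ)) →
      IntegrableOn f (Ioi 0) ∧ IntegrableOn (fun y => y * f y) (Ioi 0) := by
    intro f hf hi
    constructor
    · apply Integrable.mono hi hf.aestronglyMeasurable
      filter_upwards [ae_restrict_mem measurableSet_Ioi] with y hy
      rw [norm_mul]
      apply le_mul_of_one_le_left (norm_nonneg _)
      rw [Real.norm_eq_abs, abs_of_pos (by linarith [mem_Ioi.1 hy])]
      linarith [mem_Ioi.1 hy]
    · apply Integrable.mono hi (by fun_prop)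
      filter_upwards [ae_restrict_mem measurableSet_Ioi] with y hy
      have := mem_Ioi.1 hy
      rw [norm_mul, norm_mul]
      gcongr
      rw [Real.norm_eq_abs, Real.norm_eq_abs, abs_of_pos this, abs_of_pos (by linarith)]
      linarith
  obtain ⟨a1, b1⟩ := kk u1 c1 i1
  obtain ⟨a2, b2⟩ := kk u2 c2 i2
  obtain ⟨a3, b3⟩ := kk u3 c3 i3
  have t1 : Tendsto u1 atTop (nhds 0) :=
    tendsto_zero_of_hasDerivAt_of_integrableOn_Ioi (a := 0) (fun y _ => d1 y) a2 a1
  have t2 : Tendsto u2 atTop (nhds 0) :=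
    tendsto_zero_of_hasDerivAt_of_integrableOn_Ioi (a := 0) (fun y _ => d2 y) a3 a2
  have dy1 : ∀ y, HasDerivAt (fun y => y * u1 y) (1 * u1 y + y * u2 y) y :=
    fun y => (hasDerivAt_id y).mul (d1 y)
  have ty1 : Tendsto (fun y => y * u1 y) atTop (nhds 0) := by
    refine tendsto_zero_of_hasDerivAt_of_integrableOn_Ioi (a := 0) (fun y _ => dy1 y) ?_ b1
    simp only [one_mul]
    exact a1.add b2
  have ty2 : Tendsto (fun y => y * u2 y) atTop (nhds 0) := by
    refine tendsto_zero_of_hasDerivAt_of_integrableOn_Ioi (a := 0)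
      (fun y _ => (hasDerivAt_id y).mul (d2 y)) ?_ b2
    simp only [one_mul]
    exact a2.add b3
  have tF : Tendsto (fun y => 1 - U y + y * u1 y) atTop (nhds 0) := by
    have := (hU.tendsto_one.const_sub 1).add ty1
    simpa using this
  have iF : IntegrableOn (fun y => 1 - U y + y * u1 y) (Ioi 0) := hU.integrable_defect.add b1
  refine ⟨?_, ⟨hU.tendsto_one, t1, t2, ty2, tF, iF⟩⟩
  have iM : IntegrableOn (fun y => (1 + y) * (|u1 y| + |u2 y| + |u3 y|)) (Ioi 0) := by
    refine ((i1.norm.add i2.norm).add i3.norm).congr ?_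
    filter_upwards [ae_restrict_mem measurableSet_Ioi] with y hy
    have := mem_Ioi.1 hy
    simp only [Pi.add_apply, norm_mul, Real.norm_eq_abs]
    rw [abs_of_pos (by linarith : 0 < 1 + y)]; ring
  have iM2 : IntegrableOn (fun y => ((1 + y) * (|u1 y| + |u2 y| + |u3 y|))^2) (Ioi 0) := by
    refine Integrable.mono' (((j1.add j2).add j3).const_mul 3)
      (Continuous.aestronglyMeasurable (by fun_prop)) ?_
    filter_upwards [ae_restrict_mem measurableSet_Ioi] with y hy
    simp only [Pi.add_apply, mul_pow]
    rw [Real.norm_eq_abs, abs_of_nonneg (by positivity), ← sq_abs (u1 y), ← sq_abs (u2 y),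
      ← sq_abs (u3 y), ← mul_add, ← mul_add, mul_left_comm]
    apply mul_le_mul_of_nonneg_left _ (sq_nonneg _)
    nlinarith [sq_nonneg (|u1 y| - |u2 y|), sq_nonneg (|u1 y| - |u3 y|),
      sq_nonneg (|u2 y| - |u3 y|)]
  set m1 := ∫ y in Ioi (0:ℝ), (1 + y) * (|u1 y| + |u2 y| + |u3 y|) with hm1
  set m2 := ∫ y in Ioi (0:ℝ), ((1 + y) * (|u1 y| + |u2 y| + |u3 y|))^2 with hm2
  set m3 := ∫ y in Ioi (0:ℝ), |1 - U y + y * u1 y| with hm3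
  have I1 : ∀ R, 0 ≤ R → ∫ y in (0:ℝ)..R, (1 + y) * (|u1 y| + |u2 y| + |u3 y|) ≤ m1 :=
    fun R hR => interval_le_Ioi iM (fun y hy => by positivity) hR
  have I2 : ∀ R, 0 ≤ R → ∫ y in (0:ℝ)..R, ((1 + y) * (|u1 y| + |u2 y| + |u3 y|))^2 ≤ m2 :=
    fun R hR => interval_le_Ioi iM2 (fun y hy => by positivity) hR
  have IF : ∀ R, 0 ≤ R → ∫ y in (0:ℝ)..R, |1 - U y + y * u1 y| ≤ m3 :=
    fun R hR => interval_le_Ioi iF.norm (fun y hy => by positivity) hR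
  have z1 : 0 ≤ m1 := by simpa using I1 0 le_rfl
  have z2 : 0 ≤ m2 := by simpa using I2 0 le_rfl
  have z3 : 0 ≤ m3 := by simpa using IF 0 le_rfl
  have bF : ∀ y, 0 ≤ y → |1 - U y + y * u1 y| ≤ 1 + m1 := by
    intro y hy
    have dF : ∀ y, HasDerivAt (fun y => 1 - U y + y * u1 y) (-u1 y + (1 * u1 y + y * u2 y)) y :=
      fun y => ((d0 y).const_sub 1).add (dy1 y)
    have ftc := intervalIntegral.integral_eq_sub_of_hasDerivAt (a := 0) (b := y)
      (fun y _ => dF y) (Continuous.intervalIntegrable (by fun_prop) _ _)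
    have e : 1 - U y + y * u1 y = 1 + ∫ t in (0:ℝ)..y, (-u1 t + (1 * u1 t + t * u2 t)) := by
      rw [ftc]; simp [hU.zero_val]
    rw [e]
    refine (abs_add_le _ _).trans ?_
    rw [abs_one]
    gcongr
    refine (intervalIntegral.abs_integral_le_integral_abs hy).trans (le_trans ?_ (I1 y hy))
    apply intervalIntegral.integral_mono_on hy
    · exact Continuous.intervalIntegrable (by fun_prop) _ _
    · exact Continuous.intervalIntegrable (by fun_prop) _ _
    intro t ht
    have := abs_nonneg (u1 t)
    have := abs_nonneg (u3 t)
    rw [show -u1 t + (1 * u1 t + t * u2 t) = t * u2 t by ring, abs_mul, abs_of_nonneg ht.1]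
    have := ht.1
    gcongr <;> linarith
  have zM1 := (abs_nonneg _).trans (hM1 0 le_rfl)
  have zM2 := (abs_nonneg _).trans (hM2 0 le_rfl)
  have zM3 := (abs_nonneg _).trans (hM3 0 le_rfl)
  refine ⟨1 + m1 + m2 + m3 + M1 + M2 + M3, ⟨d0, d1, d2, c3, ?_, ?_, ?_, ?_, ?_, ?_, ?_, ?_, ?_⟩⟩
  · intro y hy
    have := hU.mem_Ico y hy
    exact ⟨this.1, this.2.le⟩
  · intro y hy; linarith [hM1 y hy]
  · intro y hy; linarith [hM2 y hy]
  · intro y hy; linarith [hM3 y hy]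
  · linarith
  · intro y hy; linarith [I1 y hy]
  · intro y hy; linarith [I2 y hy]
  · intro y hy; linarith [bF y hy]
  · intro y hy; linarith [IF y hy]
end
end

section
open MeasureTheory Filter Set
noncomputable section

theorem smooth_of_deriv {f g : ℝ → ℂ} {n : ℕ} (h : ∀ y, HasDerivAt f (g y) y)
    (hg : ContDiff ℝ n g) : ContDiff ℝ (n + 1 : ℕ) f := by
  have e : deriv f = g := funext fun y => (h y).deriv
  have : ((n + 1 : ℕ) : WithTop ℕ∞) = (n : WithTop ℕ∞) + 1 := by push_cast; rfl
  rw [this, contDiff_succ_iff_deriv]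
  refine ⟨fun y => (h y).differentiableAt, ?_, by rwa [e]⟩
  intro h0
  exact absurd h0 (by simp)

theorem ode3 (c0 c1 c2 b : ℝ → ℂ) (h0 : ContDiff ℝ (⊤ : ℕ∞) c0) (h1 : ContDiff ℝ (⊤ : ℕ∞) c1)
    (h2 : ContDiff ℝ (⊤ : ℕ∞) c2) (hb : ContDiff ℝ (⊤ : ℕ∞) b) (x0 x1 x2 : ℂ) :
    ∃ Ψ q r : ℝ → ℂ, Ψ 0 = x0 ∧ q 0 = x1 ∧ r 0 = x2 ∧ ContDiff ℝ (⊤ : ℕ∞) Ψ ∧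
      (∀ y, HasDerivAt Ψ (q y) y) ∧ (∀ y, HasDerivAt q (r y) y) ∧
      (∀ y, HasDerivAt r (c0 y * Ψ y + c1 y * q y + c2 y * r y + b y) y) := by
  have k0 := h0.continuous
  have k1 := h1.continuous
  have k2 := h2.continuous
  have kb := hb.continuous
  let p0 : (ℂ × ℂ × ℂ) →L[ℝ] ℂ := ContinuousLinearMap.fst ℝ ℂ (ℂ × ℂ)
  let p1 : (ℂ × ℂ × ℂ) →L[ℝ] ℂ := (ContinuousLinearMap.fst ℝ ℂ ℂ).comp (ContinuousLinearMap.snd ℝ ℂ (ℂ × ℂ))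
  let p2 : (ℂ × ℂ × ℂ) →L[ℝ] ℂ := (ContinuousLinearMap.snd ℝ ℂ ℂ).comp (ContinuousLinearMap.snd ℝ ℂ (ℂ × ℂ))
  let ι : ℂ →L[ℝ] (ℂ × ℂ × ℂ) := (ContinuousLinearMap.inr ℝ ℂ (ℂ × ℂ)).comp (ContinuousLinearMap.inr ℝ ℂ ℂ)
  let A0 : (ℂ × ℂ × ℂ) →L[ℝ] (ℂ × ℂ × ℂ) := p1.prod (p2.prod 0)
  let A : ℝ → (ℂ × ℂ × ℂ) →L[ℝ] (ℂ × ℂ × ℂ) := fun t =>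
    A0 + c0 t • (ι.comp p0) + c1 t • (ι.comp p1) + c2 t • (ι.comp p2)
  have hA : Continuous A := by
    simp only [A]
    fun_prop
  obtain ⟨x, hx0, hx⟩ := linear_ode A hA (fun t => ((0, 0, b t) : ℂ × ℂ × ℂ)) (by fun_prop) (x0, x1, x2)
  have hv : ∀ t, A t (x t) + ((0, 0, b t) : ℂ × ℂ × ℂ)
      = ((x t).2.1, (x t).2.2, c0 t * (x t).1 + c1 t * (x t).2.1 + c2 t * (x t).2.2 + b t) := by
    intro t
    simp [A, A0, ι, p0, p1, p2]
  have e0 : ∀ y, HasDerivAt (fun y => (x y).1) ((x y).2.1) y := by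
    intro y
    have := (p0.hasFDerivAt.comp_hasDerivAt y (hx y))
    rw [hv] at this
    exact this
  have e1 : ∀ y, HasDerivAt (fun y => (x y).2.1) ((x y).2.2) y := by
    intro y
    have := (p1.hasFDerivAt.comp_hasDerivAt y (hx y))
    rw [hv] at this
    exact this
  have e2 : ∀ y, HasDerivAt (fun y => (x y).2.2)
      (c0 y * (x y).1 + c1 y * (x y).2.1 + c2 y * (x y).2.2 + b y) y := by
    intro y
    have := (p2.hasFDerivAt.comp_hasDerivAt y (hx y))
    rw [hv] at this
    exact this
  refine ⟨fun y => (x y).1, fun y => (x y).2.1, fun y => (x y).2.2, by simp [hx0], by simp [hx0],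
    by simp [hx0], ?_, e0, e1, e2⟩
  have key : ∀ n : ℕ, ContDiff ℝ n (fun y => (x y).1) ∧ ContDiff ℝ n (fun y => (x y).2.1) ∧
      ContDiff ℝ n (fun y => (x y).2.2) := by
    intro n
    induction n with
    | zero =>
      simp only [Nat.cast_zero, contDiff_zero]
      exact ⟨continuous_iff_continuousAt.2 fun y => (e0 y).continuousAt,
        continuous_iff_continuousAt.2 fun y => (e1 y).continuousAt,
        continuous_iff_continuousAt.2 fun y => (e2 y).continuousAt⟩
    | succ n ih =>
      obtain ⟨i0, i1, i2⟩ := ih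
      have l : ((n : ℕ) : WithTop ℕ∞) ≤ ((⊤ : ℕ∞) : WithTop ℕ∞) := by exact_mod_cast le_top
      refine ⟨smooth_of_deriv e0 i1, smooth_of_deriv e1 i2, smooth_of_deriv e2 ?_⟩
      exact ((((h0.of_le l).mul i0).add ((h1.of_le l).mul i1)).add ((h2.of_le l).mul i2)).add
        (hb.of_le l)
  exact contDiff_infty.2 fun n => (key n).1
end
end

section
open MeasureTheory Filter Set
noncomputable section

def pz (U u1 : ℝ → ℝ) (μ : ℂ) (y : ℝ) : ℂ := ((1 - U y + y * u1 y : ℝ) : ℂ) / (μ - U y) ^ 2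

def pz1 (U u1 u2 : ℝ → ℝ) (μ : ℂ) (y : ℝ) : ℂ :=
  ((y * u2 y : ℝ) : ℂ) / (μ - U y) ^ 2
    + ((2 * (1 - U y + y * u1 y) * u1 y : ℝ) : ℂ) / (μ - U y) ^ 3

def pz2 (U u1 u2 u3 : ℝ → ℝ) (μ : ℂ) (y : ℝ) : ℂ :=
  ((u2 y + y * u3 y : ℝ) : ℂ) / (μ - U y) ^ 2
    + ((4 * (y * u2 y) * u1 y + 2 * (1 - U y + y * u1 y) * u2 y : ℝ) : ℂ) / (μ - U y) ^ 3
    + ((6 * (1 - U y + y * u1 y) * u1 y ^ 2 : ℝ) : ℂ) / (μ - U y) ^ 4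

def Pz (U u1 : ℝ → ℝ) (μ : ℂ) (y : ℝ) : ℂ := ∫ t in (0:ℝ)..y, pz U u1 μ t

def gg (U u1 u2 u3 : ℝ → ℝ) (μ : ℂ) (y : ℝ) : ℂ :=
  pz2 U u1 u2 u3 μ y - (3 * u1 y * pz1 U u1 u2 μ y + 3 * u2 y * pz U u1 μ y
    + u3 y * Pz U u1 μ y) / (μ - U y)

section
variable {U u1 u2 u3 : ℝ → ℝ} {μ : ℂ} {B η : ℝ}

theorem pz_deriv (hη : 0 < η) (hμ : η ≤ μ.im) (hd : FlowDat U u1 u2 u3 B) (y : ℝ) :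
    HasDerivAt (pz U u1 μ) (pz1 U u1 u2 μ y) y := by
  have ha := QSol.a_ne (U := U) hη hμ y
  have da : HasDerivAt (fun y => μ - (U y : ℂ)) (-(u1 y : ℂ)) y :=
    ((hd.d0 y).ofReal_comp).const_sub μ
  have dF : HasDerivAt (fun y => 1 - U y + y * u1 y) (-u1 y + (1 * u1 y + y * u2 y)) y :=
    ((hd.d0 y).const_sub 1).add ((hasDerivAt_id y).mul (hd.d1 y))
  have := dF.ofReal_comp.div (da.pow 2) (pow_ne_zero 2 ha)
  refine this.congr_deriv ?_
  simp only [pz1, Pi.pow_apply]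
  push_cast
  field_simp
  ring

theorem pz1_deriv (hη : 0 < η) (hμ : η ≤ μ.im) (hd : FlowDat U u1 u2 u3 B) (y : ℝ) :
    HasDerivAt (pz1 U u1 u2 μ) (pz2 U u1 u2 u3 μ y) y := by
  have ha := QSol.a_ne (U := U) hη hμ y
  have da : HasDerivAt (fun y => μ - (U y : ℂ)) (-(u1 y : ℂ)) y :=
    ((hd.d0 y).ofReal_comp).const_sub μ
  have dF : HasDerivAt (fun y => 1 - U y + y * u1 y) (-u1 y + (1 * u1 y + y * u2 y)) y :=
    ((hd.d0 y).const_sub 1).add ((hasDerivAt_id y).mul (hd.d1 y))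
  have d1 : HasDerivAt (fun y => y * u2 y) (1 * u2 y + y * u3 y) y :=
    (hasDerivAt_id y).mul (hd.d2 y)
  have := (d1.ofReal_comp.div (da.pow 2) (pow_ne_zero 2 ha)).add
    (((dF.const_mul 2).mul (hd.d1 y)).ofReal_comp.div (da.pow 3) (pow_ne_zero 3 ha))
  refine this.congr_deriv ?_
  simp only [pz2, Pi.pow_apply, Pi.mul_apply]
  push_cast
  field_simp
  ring

theorem pz_cont (hη : 0 < η) (hμ : η ≤ μ.im) (hd : FlowDat U u1 u2 u3 B) :
    Continuous (pz U u1 μ) :=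
  continuous_iff_continuousAt.2 fun y => (pz_deriv hη hμ hd y).continuousAt

theorem Pz_deriv (hη : 0 < η) (hμ : η ≤ μ.im) (hd : FlowDat U u1 u2 u3 B) (y : ℝ) :
    HasDerivAt (Pz U u1 μ) (pz U u1 μ y) y := by
  have c := pz_cont hη hμ hd
  exact intervalIntegral.integral_hasDerivAt_right (c.intervalIntegrable _ _)
    (c.stronglyMeasurableAtFilter _ _) c.continuousAt

theorem gg_cont (hη : 0 < η) (hμ : η ≤ μ.im) (hd : FlowDat U u1 u2 u3 B) :
    Continuous (gg U u1 u2 u3 μ) := by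
  have c0 := pz_cont hη hμ hd
  have c1 : Continuous (pz1 U u1 u2 μ) :=
    continuous_iff_continuousAt.2 fun y => (pz1_deriv hη hμ hd y).continuousAt
  have c2 : Continuous (Pz U u1 μ) :=
    continuous_iff_continuousAt.2 fun y => (Pz_deriv hη hμ hd y).continuousAt
  have ha := QSol.a_ne (U := U) hη hμ
  have ha2 : ∀ y, (μ - U y)^2 ≠ 0 := fun y => pow_ne_zero 2 (ha y)
  have ha3 : ∀ y, (μ - U y)^3 ≠ 0 := fun y => pow_ne_zero 3 (ha y)
  have ha4 : ∀ y, (μ - U y)^4 ≠ 0 := fun y => pow_ne_zero 4 (ha y)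
  have k1 := hd.c1
  have k2 := hd.c2
  have k3 := hd.c3
  have kU := hd.cU
  unfold gg pz2
  fun_prop (disch := assumption)

theorem div_pow_bd {a : ℂ} (hη : 0 < η) (ha : η ≤ ‖a‖) (n : ℝ) {N : ℝ} (hn : |n| ≤ N) (j : ℕ) :
    ‖(n : ℂ) / a ^ (j + 1)‖ ≤ N * (1/η) ^ j / ‖a‖ := by
  have ha0 : 0 < ‖a‖ := hη.trans_le ha
  have hN : 0 ≤ N := (abs_nonneg _).trans hn
  rw [norm_div, Complex.norm_real, Real.norm_eq_abs, norm_pow, pow_succ, ← div_div]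
  gcongr
  rw [div_eq_mul_inv, ← inv_pow]
  gcongr
  rw [one_div]
  gcongr

theorem pz_bd (hη : 0 < η) (hμ : η ≤ μ.im) (y : ℝ) :
    ‖pz U u1 μ y‖ ≤ |1 - U y + y * u1 y| * (1/η)^2 := by
  have ha := QSol.a_low (U := U) hμ y
  have := div_pow_bd hη ha _ (le_refl |1 - U y + y * u1 y|) 1
  refine this.trans ?_
  rw [pow_one, sq, ← mul_assoc, div_eq_mul_inv]
  gcongr
  rw [one_div]
  gcongr

theorem Pz_bd (hη : 0 < η) (hμ : η ≤ μ.im) (hd : FlowDat U u1 u2 u3 B) (y : ℝ) (hy : 0 ≤ y) :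
    ‖Pz U u1 μ y‖ ≤ B * (1/η)^2 := by
  have c := pz_cont hη hμ hd
  have k1 := hd.c1
  have kU := hd.cU
  refine (intervalIntegral.norm_integral_le_integral_norm hy).trans ?_
  have : ∫ t in (0:ℝ)..y, ‖pz U u1 μ t‖ ≤
      ∫ t in (0:ℝ)..y, |1 - U t + t * u1 t| * (1/η)^2 := by
    apply intervalIntegral.integral_mono_on hy
    · exact Continuous.intervalIntegrable (by fun_prop) _ _
    · exact Continuous.intervalIntegrable (by fun_prop) _ _
    · exact fun t _ => pz_bd hη hμ t
  refine this.trans ?_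
  rw [intervalIntegral.integral_mul_const]
  gcongr
  exact hd.IF y hy

def Cg (B η : ℝ) : ℝ := (1/η) + 13 * B * (1/η)^2 + 12 * B^2 * (1/η)^3

set_option maxHeartbeats 1000000 in
theorem gg_bd (hη : 0 < η) (hμ : η ≤ μ.im) (hd : FlowDat U u1 u2 u3 B) (y : ℝ) (hy : 0 ≤ y) :
    ‖gg U u1 u2 u3 μ y‖ ≤ Cg B η * ((1 + y) * (|u1 y| + |u2 y| + |u3 y|)) / ‖μ - U y‖ := by
  have ha := QSol.a_low (U := U) hμ y
  have ha0 : 0 < ‖μ - U y‖ := hη.trans_le ha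
  have hB : 0 ≤ B := zero_le_one.trans hd.one_le
  have b1 := hd.b1 y hy
  have bF := hd.bF y hy
  have bP := Pz_bd hη hμ hd y hy
  have p1 := abs_nonneg (u1 y)
  have p2 := abs_nonneg (u2 y)
  have p3 := abs_nonneg (u3 y)
  set m := (1 + y) * (|u1 y| + |u2 y| + |u3 y|) with hm
  have hm0 : 0 ≤ m := by positivity
  have m1 : |u1 y| ≤ m := by rw [hm]; nlinarith [mul_nonneg hy p1, mul_nonneg hy p2, mul_nonneg hy p3]
  have m2 : |u2 y| ≤ m := by rw [hm]; nlinarith [mul_nonneg hy p1, mul_nonneg hy p2, mul_nonneg hy p3]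
  have m3 : |u3 y| ≤ m := by rw [hm]; nlinarith [mul_nonneg hy p1, mul_nonneg hy p2, mul_nonneg hy p3]
  have m4 : |y * u2 y| ≤ m := by
    rw [abs_mul, abs_of_nonneg hy, hm]
    nlinarith [mul_nonneg hy p1, mul_nonneg hy p2, mul_nonneg hy p3]
  have m5 : |u2 y + y * u3 y| ≤ m := by
    refine (abs_add_le _ _).trans ?_
    rw [abs_mul, abs_of_nonneg hy, hm]
    nlinarith [mul_nonneg hy p1, mul_nonneg hy p2, mul_nonneg hy p3]
  set F := 1 - U y + y * u1 y with hF
  have n1 : |4 * (y * u2 y) * u1 y + 2 * F * u2 y| ≤ 6 * B * m := by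
    refine (abs_add_le _ _).trans ?_
    have x1 : |4 * (y * u2 y) * u1 y| ≤ 4 * m * B := by
      rw [abs_mul, abs_mul, abs_of_pos (by norm_num : (0:ℝ) < 4)]
      gcongr
    have x2 : |2 * F * u2 y| ≤ 2 * B * m := by
      rw [abs_mul, abs_mul, abs_of_pos (by norm_num : (0:ℝ) < 2)]
      gcongr
    linarith
  have n2 : |6 * F * u1 y ^ 2| ≤ 6 * B^2 * m := by
    rw [abs_mul, abs_mul, abs_of_pos (by norm_num : (0:ℝ) < 6), abs_pow]
    calc 6 * |F| * |u1 y|^2 = 6 * |F| * (|u1 y| * |u1 y|) := by ring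
      _ ≤ 6 * B * (B * m) := by gcongr
      _ = _ := by ring
  have n3 : |3 * u1 y * (y * u2 y)| ≤ 3 * B * m := by
    rw [abs_mul, abs_mul, abs_of_pos (by norm_num : (0:ℝ) < 3)]
    gcongr
  have n4 : |3 * u1 y * (2 * F * u1 y)| ≤ 6 * B^2 * m := by
    rw [abs_mul, abs_mul, abs_mul, abs_mul, abs_of_pos (by norm_num : (0:ℝ) < 3),
      abs_of_pos (by norm_num : (0:ℝ) < 2)]
    calc 3 * |u1 y| * (2 * |F| * |u1 y|) ≤ 3 * B * (2 * B * m) := by gcongr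
      _ = _ := by ring
  have n5 : |3 * u2 y * F| ≤ 3 * B * m := by
    rw [abs_mul, abs_mul, abs_of_pos (by norm_num : (0:ℝ) < 3)]
    calc 3 * |u2 y| * |F| ≤ 3 * m * B := by gcongr
      _ = _ := by ring
  have hane : μ - (U y : ℂ) ≠ 0 := QSol.a_ne (U := U) hη hμ y
  have e : gg U u1 u2 u3 μ y = ((u2 y + y * u3 y : ℝ) : ℂ) / (μ - U y) ^ (1 + 1)
    + ((4 * (y * u2 y) * u1 y + 2 * F * u2 y : ℝ) : ℂ) / (μ - U y) ^ (2 + 1)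
    + ((6 * F * u1 y ^ 2 : ℝ) : ℂ) / (μ - U y) ^ (3 + 1)
    - ((3 * u1 y * (y * u2 y) : ℝ) : ℂ) / (μ - U y) ^ (2 + 1)
    - ((3 * u1 y * (2 * F * u1 y) : ℝ) : ℂ) / (μ - U y) ^ (3 + 1)
    - ((3 * u2 y * F : ℝ) : ℂ) / (μ - U y) ^ (2 + 1)
    - ((u3 y : ℝ) : ℂ) / (μ - U y) ^ (0 + 1) * Pz U u1 μ y := by
    simp only [gg, pz2, pz1, pz, ← hF]
    push_cast
    field_simp
    ring
  have t1 := div_pow_bd hη ha _ m5 1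
  have t2 := div_pow_bd hη ha _ n1 2
  have t3 := div_pow_bd hη ha _ n2 3
  have t4 := div_pow_bd hη ha _ n3 2
  have t5 := div_pow_bd hη ha _ n4 3
  have t6 := div_pow_bd hη ha _ n5 2
  have t7 := div_pow_bd hη ha _ m3 0
  have t8 : ‖((u3 y : ℝ) : ℂ) / (μ - U y) ^ (0 + 1) * Pz U u1 μ y‖
      ≤ m * (1/η)^0 / ‖μ - U y‖ * (B * (1/η)^2) := by
    rw [norm_mul]; gcongr
  rw [e]
  refine (norm_sub_le _ _).trans ?_
  refine (add_le_add (norm_sub_le _ _) t8).trans ?_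
  refine (add_le_add (add_le_add (norm_sub_le _ _) t6) le_rfl).trans ?_
  refine (add_le_add (add_le_add (add_le_add (norm_sub_le _ _) t5) le_rfl) le_rfl).trans ?_
  refine (add_le_add (add_le_add (add_le_add (add_le_add (norm_add₃_le) t4) le_rfl) le_rfl)
    le_rfl).trans ?_
  refine (add_le_add (add_le_add (add_le_add (add_le_add (add_le_add (add_le_add t1 t2) t3)
    le_rfl) le_rfl) le_rfl) le_rfl).trans ?_
  apply le_of_eq
  simp only [Cg]
  ring

theorem norm_mu (hη : 0 < η) (hμ : η ≤ μ.im) (hd : FlowDat U u1 u2 u3 B) (y : ℝ) (hy : 0 ≤ y) :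
    ‖μ‖ ≤ (1 + 1/η) * ‖μ - U y‖ := by
  have ha := QSol.a_low (U := U) hμ y
  have h1 : ‖μ‖ ≤ ‖μ - U y‖ + 1 := by
    have e : μ = (μ - U y) + (U y : ℂ) := by ring
    have hu := hd.U01 y hy
    calc ‖μ‖ = ‖(μ - U y) + (U y : ℂ)‖ := by rw [← e]
      _ ≤ _ := norm_add_le _ _
      _ ≤ _ := by
        gcongr
        rw [Complex.norm_real, Real.norm_eq_abs, abs_of_nonneg hu.1]
        exact hu.2
  have e4 : 1 ≤ 1/η * ‖μ - U y‖ := by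
    rw [one_div_mul_eq_div, one_le_div hη]; exact ha
  linarith

theorem mu_low (hμ : η ≤ μ.im) : η ≤ ‖μ‖ :=
  hμ.trans ((le_abs_self _).trans (Complex.abs_im_le_norm μ))

theorem gg_bd' (hη : 0 < η) (hμ : η ≤ μ.im) (hd : FlowDat U u1 u2 u3 B) (y : ℝ) (hy : 0 ≤ y) :
    ‖gg U u1 u2 u3 μ y‖ ≤
      Cg B η * (1 + 1/η) / ‖μ‖ * ((1 + y) * (|u1 y| + |u2 y| + |u3 y|)) := by
  refine (gg_bd hη hμ hd y hy).trans ?_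
  have hB : 0 ≤ B := zero_le_one.trans hd.one_le
  have h1 := norm_mu hη hμ hd y hy
  have h2 := hη.trans_le (mu_low hμ)
  have h3 := hη.trans_le (QSol.a_low (U := U) hμ y)
  have hC : 0 ≤ Cg B η := by unfold Cg; positivity
  set m := (1 + y) * (|u1 y| + |u2 y| + |u3 y|) with hm
  have hm0 : 0 ≤ m := by positivity
  have : 1 / ‖μ - U y‖ ≤ (1 + 1/η) / ‖μ‖ := by
    rw [div_le_div_iff₀ h3 h2]; linarith
  calc Cg B η * m / ‖μ - U y‖ = Cg B η * m * (1 / ‖μ - U y‖) := by ring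
    _ ≤ Cg B η * m * ((1 + 1/η) / ‖μ‖) := by gcongr
    _ = _ := by ring

def Gg (B η : ℝ) : ℝ := (Cg B η * (1 + 1/η))^2 * B + Cg B η * (1 + 1/η) / η * B

theorem Gg_nonneg (hη : 0 < η) (hB : 1 ≤ B) : 0 ≤ Gg B η := by
  unfold Gg Cg; positivity

theorem gg_int (hη : 0 < η) (hμ : η ≤ μ.im) (hd : FlowDat U u1 u2 u3 B) (R : ℝ) (hR : 0 ≤ R) :
    ∫ y in (0:ℝ)..R, ‖gg U u1 u2 u3 μ y‖ ≤ Gg B η := by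
  have hB : 0 ≤ B := zero_le_one.trans hd.one_le
  have c := gg_cont hη hμ hd
  have k1 := hd.c1
  have k2 := hd.c2
  have k3 := hd.c3
  have hC : 0 ≤ Cg B η := by unfold Cg; positivity
  have hm := mu_low hμ
  have hm0 := hη.trans_le hm
  have := intervalIntegral.integral_mono_on (μ := volume) hR
    (Continuous.intervalIntegrable (by fun_prop) _ _)
    (Continuous.intervalIntegrable (by fun_prop) _ _)
    (fun y hy => gg_bd' hη hμ hd y hy.1)
  refine this.trans ?_
  rw [intervalIntegral.integral_const_mul]
  have h1 := hd.I1 R hR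
  have h0 : 0 ≤ ∫ y in (0:ℝ)..R, (1 + y) * (|u1 y| + |u2 y| + |u3 y|) :=
    intervalIntegral.integral_nonneg hR fun y hy => by
      have := hy.1
      positivity
  have : Cg B η * (1 + 1/η) / ‖μ‖ * ∫ y in (0:ℝ)..R, (1 + y) * (|u1 y| + |u2 y| + |u3 y|)
      ≤ Cg B η * (1 + 1/η) / η * B := by gcongr
  refine this.trans ?_
  unfold Gg
  have : 0 ≤ (Cg B η * (1 + 1/η))^2 * B := by positivity
  linarith

theorem gg_int2 (hη : 0 < η) (hμ : η ≤ μ.im) (hd : FlowDat U u1 u2 u3 B) (R : ℝ) (hR : 0 ≤ R) :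
    ∫ y in (0:ℝ)..R, ‖gg U u1 u2 u3 μ y‖^2 ≤ Gg B η / ‖μ‖^2 := by
  have hB : 0 ≤ B := zero_le_one.trans hd.one_le
  have c := gg_cont hη hμ hd
  have k1 := hd.c1
  have k2 := hd.c2
  have k3 := hd.c3
  have hC : 0 ≤ Cg B η := by unfold Cg; positivity
  have hm := mu_low hμ
  have hm0 := hη.trans_le hm
  have := intervalIntegral.integral_mono_on (μ := volume) hR
    (f := fun y => ‖gg U u1 u2 u3 μ y‖^2)
    (g := fun y => (Cg B η * (1 + 1/η) / ‖μ‖)^2 * ((1 + y) * (|u1 y| + |u2 y| + |u3 y|))^2)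
    (Continuous.intervalIntegrable (by fun_prop) _ _)
    (Continuous.intervalIntegrable (by fun_prop) _ _)
    (fun y hy => by
      rw [← mul_pow]
      exact pow_le_pow_left₀ (norm_nonneg _) (gg_bd' hη hμ hd y hy.1) 2)
  refine this.trans ?_
  rw [intervalIntegral.integral_const_mul]
  have h1 := hd.I2 R hR
  have h2 : (Cg B η * (1 + 1/η) / ‖μ‖)^2
      * ∫ y in (0:ℝ)..R, ((1 + y) * (|u1 y| + |u2 y| + |u3 y|))^2
      ≤ (Cg B η * (1 + 1/η) / ‖μ‖)^2 * B := by gcongr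
  refine h2.trans ?_
  rw [div_pow, div_mul_eq_mul_div]
  gcongr
  unfold Gg
  have : 0 ≤ Cg B η * (1 + 1/η) / η * B := by positivity
  linarith

/-- Derivatives of `φ = a (Ψ + Pz)`. -/
theorem bridge (hη : 0 < η) (hμ : η ≤ μ.im) (hd : FlowDat U u1 u2 u3 B) {Ψ q r s φ : ℝ → ℂ}
    (dΨ : ∀ y, HasDerivAt Ψ (q y) y) (dq : ∀ y, HasDerivAt q (r y) y)
    (dr : ∀ y, HasDerivAt r (s y) y) (hφ : ∀ y, φ y = (μ - U y) * (Ψ y + Pz U u1 μ y)) :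
    (∀ y, deriv φ y = (μ - U y) * (q y + pz U u1 μ y) - u1 y * (Ψ y + Pz U u1 μ y)) ∧
    (∀ y, HasDerivAt φ (deriv φ y) y) ∧
    (∀ y, HasDerivAt (deriv φ) (deriv (deriv φ) y) y) ∧
    (∀ y, HasDerivAt (deriv (deriv φ)) (iteratedDeriv 3 φ y) y) ∧
    (∀ y, deriv (deriv φ) y = (μ - U y) * (r y + pz1 U u1 u2 μ y) - 2 * u1 y * (q y + pz U u1 μ y)
        - u2 y * (Ψ y + Pz U u1 μ y)) ∧
    (∀ y, iteratedDeriv 3 φ y = (μ - U y) * (s y + pz2 U u1 u2 u3 μ y)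
      - 3 * u1 y * (r y + pz1 U u1 u2 μ y) - 3 * u2 y * (q y + pz U u1 μ y)
        - u3 y * (Ψ y + Pz U u1 μ y)) := by
  have hφ' : φ = fun y => (μ - U y) * (Ψ y + Pz U u1 μ y) := funext hφ
  have da : ∀ y, HasDerivAt (fun y => μ - (U y : ℂ)) (-(u1 y : ℂ)) y :=
    fun y => ((hd.d0 y).ofReal_comp).const_sub μ
  have d1 := fun y => (hd.d1 y).ofReal_comp
  have d2 := fun y => (hd.d2 y).ofReal_comp
  have A0 := fun y => (dΨ y).add (Pz_deriv hη hμ hd y)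
  have A1 := fun y => (dq y).add (pz_deriv hη hμ hd y)
  have A2 := fun y => (dr y).add (pz1_deriv hη hμ hd y)
  have f1 : ∀ y, HasDerivAt φ ((μ - U y) * (q y + pz U u1 μ y) - u1 y * (Ψ y + Pz U u1 μ y)) y := by
    intro y
    rw [hφ']
    refine ((da y).mul (A0 y)).congr_deriv ?_
    simp only [Pi.add_apply]
    ring
  have e1 : deriv φ = fun y => (μ - U y) * (q y + pz U u1 μ y) - u1 y * (Ψ y + Pz U u1 μ y) :=
    funext fun y => (f1 y).deriv
  have f2 : ∀ y, HasDerivAt (deriv φ) ((μ - U y) * (r y + pz1 U u1 u2 μ y)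
      - 2 * u1 y * (q y + pz U u1 μ y) - u2 y * (Ψ y + Pz U u1 μ y)) y := by
    intro y
    rw [e1]
    refine (((da y).mul (A1 y)).sub ((d1 y).mul (A0 y))).congr_deriv ?_
    simp only [Pi.add_apply]
    ring
  have e2 : deriv (deriv φ) = fun y => (μ - U y) * (r y + pz1 U u1 u2 μ y)
      - 2 * u1 y * (q y + pz U u1 μ y) - u2 y * (Ψ y + Pz U u1 μ y) :=
    funext fun y => (f2 y).deriv
  have f3 : ∀ y, HasDerivAt (deriv (deriv φ)) ((μ - U y) * (s y + pz2 U u1 u2 u3 μ y)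
      - 3 * u1 y * (r y + pz1 U u1 u2 μ y) - 3 * u2 y * (q y + pz U u1 μ y)
        - u3 y * (Ψ y + Pz U u1 μ y)) y := by
    intro y
    rw [e2]
    refine ((((da y).mul (A2 y)).sub (((d1 y).const_mul 2).mul (A1 y))).sub
      ((d2 y).mul (A0 y))).congr_deriv ?_
    simp only [Pi.add_apply]
    ring
  have e3 : ∀ y, iteratedDeriv 3 φ y = (μ - U y) * (s y + pz2 U u1 u2 u3 μ y)
      - 3 * u1 y * (r y + pz1 U u1 u2 μ y) - 3 * u2 y * (q y + pz U u1 μ y)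
        - u3 y * (Ψ y + Pz U u1 μ y) := by
    intro y
    rw [iteratedDeriv_succ, iteratedDeriv_succ, iteratedDeriv_one]
    exact (f3 y).deriv
  refine ⟨fun y => by rw [e1], fun y => ?_, fun y => ?_, fun y => ?_, fun y => by rw [e2], e3⟩
  · exact (f1 y).differentiableAt.hasDerivAt
  · exact (f2 y).differentiableAt.hasDerivAt
  · rw [e3]; exact f3 y

theorem ode_iff (hη : 0 < η) (hμ : η ≤ μ.im) {k : ℝ} (hk : k ≠ 0) (y : ℝ) (ψ q r s φ φ1 φ3 : ℂ)
    (h0 : φ = (μ - U y) * (ψ + Pz U u1 μ y))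
    (h1 : φ1 = (μ - U y) * (q + pz U u1 μ y) - u1 y * (ψ + Pz U u1 μ y))
    (h3 : φ3 = (μ - U y) * (s + pz2 U u1 u2 u3 μ y)
      - 3 * u1 y * (r + pz1 U u1 u2 μ y) - 3 * u2 y * (q + pz U u1 μ y)
        - u3 y * (ψ + Pz U u1 μ y)) :
    (μ - U y) * φ1 + u1 y * φ - Complex.I / (k : ℂ) * φ3 = ((1 - U y + y * u1 y : ℝ) : ℂ) ↔
    s = -Complex.I * k * (μ - U y) * q - gg U u1 u2 u3 μ y
      + (3 * u1 y * r + 3 * u2 y * q + u3 y * ψ) / (μ - U y) := by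
  have ha : μ - (U y : ℂ) ≠ 0 := QSol.a_ne (U := U) hη hμ y
  have hk' : (k : ℂ) ≠ 0 := by exact_mod_cast hk
  have hp : (μ - U y)^2 * pz U u1 μ y = ((1 - U y + y * u1 y : ℝ) : ℂ) := by
    simp only [pz]; field_simp
  have key : (μ - U y) * φ1 + u1 y * φ - Complex.I / (k : ℂ) * φ3
      - ((1 - U y + y * u1 y : ℝ) : ℂ) = -(Complex.I / k) * (μ - U y) *
      (s - (-Complex.I * k * (μ - U y) * q - gg U u1 u2 u3 μ y
      + (3 * u1 y * r + 3 * u2 y * q + u3 y * ψ) / (μ - U y))) := by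
    have hI : Complex.I / k * (-Complex.I * k) = 1 := by
      field_simp; simp
    have hg : (μ - U y) * gg U u1 u2 u3 μ y = (μ - U y) * pz2 U u1 u2 u3 μ y
        - (3 * u1 y * pz1 U u1 u2 μ y + 3 * u2 y * pz U u1 μ y + u3 y * Pz U u1 μ y) := by
      simp only [gg]
      rw [mul_sub, mul_div_cancel₀ _ ha]
    have hw : (μ - U y) * ((3 * u1 y * r + 3 * u2 y * q + u3 y * ψ) / (μ - U y))
      = 3 * u1 y * r + 3 * u2 y * q + u3 y * ψ := mul_div_cancel₀ _ ha
    rw [h0, h1, h3, ← hp]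
    linear_combination (-(μ - U y)^2 * q) * hI + (Complex.I / k) * hg - (Complex.I / k) * hw
  have hc : -(Complex.I / k) * (μ - U y) ≠ 0 :=
    mul_ne_zero (neg_ne_zero.2 (div_ne_zero Complex.I_ne_zero hk')) ha
  constructor
  · intro h
    rw [h, sub_self] at key
    have := (mul_eq_zero.1 key.symm).resolve_left hc
    exact sub_eq_zero.1 this
  · intro h
    rw [h, sub_self, mul_zero] at key
    exact sub_eq_zero.1 key
end
end
end

section
open MeasureTheory Filter Set
noncomputable section

theorem deriv_mid_tendsto {f f1 f2 : ℝ → ℂ} (d0 : ∀ y, HasDerivAt f (f1 y) y)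
    (d1 : ∀ y, HasDerivAt f1 (f2 y) y) (h0 : Tendsto f atTop (nhds 0))
    (h2 : Tendsto f2 atTop (nhds 0)) : Tendsto f1 atTop (nhds 0) := by
  rw [Metric.tendsto_atTop] at *
  intro ε hε
  obtain ⟨Y0, hY0⟩ := h0 (ε/4) (by positivity)
  obtain ⟨Y2, hY2⟩ := h2 (ε/4) (by positivity)
  refine ⟨max Y0 Y2, fun y hy => ?_⟩
  have y0 : Y0 ≤ y := (le_max_left _ _).trans hy
  have y2 : Y2 ≤ y := (le_max_right _ _).trans hy
  simp only [dist_zero_right] at *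
  have B1 : ∀ t ∈ Icc y (y+1), ‖f1 t - f1 y‖ ≤ ε/4 := by
    intro t ht
    have := Convex.norm_image_sub_le_of_norm_hasDerivWithin_le (s := Icc y (y+1)) (C := ε/4)
      (fun x _ => (d1 x).hasDerivWithinAt) (fun x hx => (hY2 x (y2.trans hx.1)).le)
      (convex_Icc _ _) (left_mem_Icc.2 (by linarith)) ht
    refine this.trans ?_
    have : ‖t - y‖ ≤ 1 := by
      rw [Real.norm_eq_abs, abs_le]; constructor <;> linarith [ht.1, ht.2]
    nlinarith
  have dh : ∀ t, HasDerivAt (fun t => f t - (t : ℂ) * f1 y) (f1 t - 1 * f1 y) t :=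
    fun t => (d0 t).sub ((hasDerivAt_id t).ofReal_comp.mul_const (f1 y))
  have B2 := Convex.norm_image_sub_le_of_norm_hasDerivWithin_le (s := Icc y (y+1)) (C := ε/4)
      (fun x _ => (dh x).hasDerivWithinAt) (fun x hx => by simpa using B1 x hx)
      (convex_Icc _ _) (left_mem_Icc.2 (by linarith)) (right_mem_Icc.2 (by linarith))
  have e : f (y+1) - ((y + 1 : ℝ) : ℂ) * f1 y - (f y - (y : ℂ) * f1 y) = f (y+1) - f y - f1 y := by
    push_cast; ring
  rw [e, add_sub_cancel_left, norm_one, mul_one] at B2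
  have B3 : ‖f1 y‖ ≤ ‖f (y+1) - f y - f1 y‖ + (‖f (y+1)‖ + ‖f y‖) := by
    have : f1 y = (f (y+1) - f y) - (f (y+1) - f y - f1 y) := by ring
    calc ‖f1 y‖ = ‖(f (y+1) - f y) - (f (y+1) - f y - f1 y)‖ := by rw [← this]
      _ ≤ ‖f (y+1) - f y‖ + ‖f (y+1) - f y - f1 y‖ := norm_sub_le _ _
      _ ≤ _ := by linarith [norm_sub_le (f (y+1)) (f y)]
  have := hY0 y y0
  have := hY0 (y+1) (by linarith)
  linarith

section
variable {U u1 u2 u3 : ℝ → ℝ} {μ : ℂ} {B η : ℝ}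

theorem ofReal_smooth {f : ℝ → ℝ} {n : WithTop ℕ∞} (h : ContDiff ℝ n f) :
    ContDiff ℝ n (fun y => (f y : ℂ)) :=
  Complex.ofRealCLM.contDiff.comp h

theorem pz_smooth (hη : 0 < η) (hμ : η ≤ μ.im) (sU : ContDiff ℝ (⊤ : ℕ∞) U)
    (s1 : ContDiff ℝ (⊤ : ℕ∞) u1) : ContDiff ℝ (⊤ : ℕ∞) (pz U u1 μ) := by
  have hU := ofReal_smooth sU
  have hF : ContDiff ℝ (⊤ : ℕ∞) (fun y => ((1 - U y + y * u1 y : ℝ) : ℂ)) := by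
    apply ofReal_smooth
    fun_prop
  unfold pz
  simp only [div_eq_mul_inv]
  exact hF.mul (ContDiff.inv (by fun_prop) (fun y => pow_ne_zero 2 (QSol.a_ne (U := U) hη hμ y)))

theorem Pz_smooth (hη : 0 < η) (hμ : η ≤ μ.im) (hd : FlowDat U u1 u2 u3 B)
    (sU : ContDiff ℝ (⊤ : ℕ∞) U)
    (s1 : ContDiff ℝ (⊤ : ℕ∞) u1) : ContDiff ℝ (⊤ : ℕ∞) (Pz U u1 μ) := by
  have := pz_smooth hη hμ sU s1
  rw [contDiff_infty] at *
  intro n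
  have := smooth_of_deriv (fun y => Pz_deriv hη hμ hd y) (this n)
  exact this.of_le (by exact_mod_cast Nat.le_succ n)

theorem q0_bd (hη : 0 < η) (hμ : η ≤ μ.im) : ‖1/μ - 1/μ^2‖ ≤ (1 + 1/η) / ‖μ‖ := by
  have hm := mu_low hμ
  have hm0 := hη.trans_le hm
  refine (norm_sub_le _ _).trans ?_
  rw [norm_div, norm_div, norm_pow, norm_one, add_div, sq, ← div_div]
  gcongr

theorem q0_eq (hη : 0 < η) (hμ : η ≤ μ.im) (hU0 : U 0 = 0) {q : ℂ} :
    (μ - U 0) * (q + pz U u1 μ 0) = 1 ↔ q = 1/μ - 1/μ^2 := by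
  have h0 : μ ≠ 0 := by
    rw [← norm_pos_iff]; exact hη.trans_le (mu_low hμ)
  simp only [pz, hU0]
  simp only [Complex.ofReal_zero, sub_zero, zero_mul, add_zero, Complex.ofReal_one]
  constructor
  · intro h
    field_simp at h ⊢
    linear_combination h
  · intro h
    rw [h]; field_simp; ring

theorem mu_sub_one_ne (hη : 0 < η) (hμ : η ≤ μ.im) : μ - 1 ≠ 0 := by
  have := QSol.a_ne (U := fun _ => 1) hη hμ 0
  simpa using this

theorem a_tendsto (hl : FlowLim U u1 u2) : Tendsto (fun y => μ - (U y : ℂ)) atTop (nhds (μ - 1)) := by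
  have := ((Complex.continuous_ofReal.tendsto 1).comp hl.t0).const_sub μ
  simpa using this

theorem ofReal_tendsto0 {f : ℝ → ℝ} (h : Tendsto f atTop (nhds 0)) :
    Tendsto (fun y => (f y : ℂ)) atTop (nhds 0) := by
  have := (Complex.continuous_ofReal.tendsto 0).comp h
  rw [Complex.ofReal_zero] at this
  exact this

theorem pz_tendsto (hη : 0 < η) (hμ : η ≤ μ.im) (hl : FlowLim U u1 u2) :
    Tendsto (pz U u1 μ) atTop (nhds 0) := by
  have := (ofReal_tendsto0 hl.tF).div ((a_tendsto (μ := μ) hl).pow 2)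
    (pow_ne_zero 2 (mu_sub_one_ne hη hμ))
  rw [zero_div] at this
  exact this

theorem pz1_tendsto (hη : 0 < η) (hμ : η ≤ μ.im) (hl : FlowLim U u1 u2) :
    Tendsto (pz1 U u1 u2 μ) atTop (nhds 0) := by
  have h1 := (ofReal_tendsto0 hl.ty2).div ((a_tendsto (μ := μ) hl).pow 2)
    (pow_ne_zero 2 (mu_sub_one_ne hη hμ))
  have h2 := (ofReal_tendsto0 (f := fun y => 2 * (1 - U y + y * u1 y) * u1 y)
    (by simpa using (hl.tF.const_mul 2).mul hl.t1)).div ((a_tendsto (μ := μ) hl).pow 3)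
    (pow_ne_zero 3 (mu_sub_one_ne hη hμ))
  have := h1.add h2
  rw [zero_div, zero_div, zero_add] at this
  exact this

theorem pz_integrable (hη : 0 < η) (hμ : η ≤ μ.im) (hd : FlowDat U u1 u2 u3 B)
    (hl : FlowLim U u1 u2) : IntegrableOn (pz U u1 μ) (Ioi 0) := by
  refine Integrable.mono' (hl.iF.norm.mul_const ((1/η)^2))
    (pz_cont hη hμ hd).aestronglyMeasurable ?_
  exact Eventually.of_forall fun y => pz_bd hη hμ y

theorem Pz_tendsto (hη : 0 < η) (hμ : η ≤ μ.im) (hd : FlowDat U u1 u2 u3 B)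
    (hl : FlowLim U u1 u2) :
    Tendsto (Pz U u1 μ) atTop (nhds (∫ y in Ioi (0:ℝ), pz U u1 μ y)) :=
  intervalIntegral_tendsto_integral_Ioi 0 (pz_integrable hη hμ hd hl) tendsto_id
end

theorem apriori (B η : ℝ) (hη : 0 < η) (hB : 1 ≤ B) :
    ∃ C : ℝ, 0 < C ∧ ∀ (U u1 u2 u3 : ℝ → ℝ) (μ : ℂ) (k : ℝ) (φ : ℝ → ℂ) (L : ℂ),
      η ≤ μ.im → FlowDat U u1 u2 u3 B → FlowLim U u1 u2 → ContDiff ℝ (⊤ : ℕ∞) U →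
      ContDiff ℝ (⊤ : ℕ∞) u1 → U 0 = 0 → 1 ≤ k → 2 * QSol.K1 B η ≤ k * η →
      ContDiff ℝ (⊤ : ℕ∞) φ →
      (∀ y, 0 ≤ y → (μ - (U y : ℂ)) * deriv φ y + ((u1 y : ℝ) : ℂ) * φ y
        - Complex.I / (k : ℂ) * iteratedDeriv 3 φ y = ((1 - U y + y * u1 y : ℝ) : ℂ)) →
      φ 0 = 0 → deriv φ 0 = 1 → Tendsto (deriv φ) atTop (nhds 0) → Tendsto φ atTop (nhds L) →
      ‖L - (μ - 1) * ∫ y in Ioi (0:ℝ), pz U u1 μ y‖ ≤ C * k ^ (-(1:ℝ)/2) := by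
  obtain ⟨C, hC, H⟩ := QSol.final_bd B η (1 + 1/η) (Gg B η) hη (by positivity)
    (Gg_nonneg hη hB) hB
  refine ⟨C, hC, ?_⟩
  intro U u1 u2 u3 μ k φ L hμ hd hl sU s1 hU0 hk hkK sφ hode hφ0 hφ1 tφ1 tφ
  have hk0 : k ≠ 0 := by positivity
  have ha := fun y => QSol.a_ne (U := U) hη hμ y
  have ta := a_tendsto (μ := μ) hl
  have ha1 := mu_sub_one_ne hη hμ
  set Ψ : ℝ → ℂ := fun y => φ y / (μ - U y) - Pz U u1 μ y with hΨ
  have sΨ : ContDiff ℝ (⊤ : ℕ∞) Ψ := by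
    have := ofReal_smooth sU
    have := Pz_smooth hη hμ hd sU s1
    simp only [hΨ, div_eq_mul_inv]
    exact (sφ.mul (ContDiff.inv (by fun_prop) ha)).sub this
  have sm : ∀ n : ℕ, Differentiable ℝ (iteratedDeriv n Ψ) := fun n =>
    sΨ.differentiable_iteratedDeriv n (by exact_mod_cast ENat.natCast_lt_top n)
  have dd : ∀ n : ℕ, ∀ y, HasDerivAt (iteratedDeriv n Ψ) (iteratedDeriv (n+1) Ψ y) y := by
    intro n y
    rw [iteratedDeriv_succ]
    exact (sm n y).hasDerivAt
  have dΨ := dd 0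
  have dq := dd 1
  have dr := dd 2
  have cs : Continuous (iteratedDeriv 3 Ψ) := (sm 3).continuous
  rw [iteratedDeriv_zero] at dΨ
  simp only [zero_add, Nat.reduceAdd] at dΨ dq dr
  set q := iteratedDeriv 1 Ψ
  set r := iteratedDeriv 2 Ψ
  set s := iteratedDeriv 3 Ψ
  clear_value q r s
  have hφ : ∀ y, φ y = (μ - U y) * (Ψ y + Pz U u1 μ y) := by
    intro y
    simp only [hΨ]
    rw [sub_add_cancel, mul_div_cancel₀ _ (ha y)]
  clear_value Ψ
  obtain ⟨e1, b1, b2, b3, e2, e3⟩ := bridge hη hμ hd dΨ dq dr hφ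
  have hPz0 : Pz U u1 μ 0 = 0 := by simp [Pz]
  have hΨ0 : Ψ 0 = 0 := by
    have := hφ 0
    rw [hφ0, hPz0, add_zero] at this
    exact (mul_eq_zero.1 this.symm).resolve_left (ha 0)
  have sol : QSol U u1 u2 u3 μ k (gg U u1 u2 u3 μ) Ψ q r s := by
    refine ⟨hΨ0, dΨ, dq, dr, cs, gg_cont hη hμ hd, fun y hy => ?_⟩
    exact (ode_iff hη hμ hk0 y _ _ _ _ _ _ _ (hφ y) (e1 y) (e3 y)).1 (hode y hy)
  have hq0 : ‖q 0‖ ≤ (1 + 1/η) / ‖μ‖ := by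
    have h1 := e1 0
    rw [hφ1, hΨ0, hPz0, add_zero, mul_zero, sub_zero] at h1
    rw [(q0_eq hη hμ hU0).1 h1.symm]
    exact q0_bd hη hμ
  -- limits
  have t1 := ofReal_tendsto0 hl.t1
  have t2 := ofReal_tendsto0 hl.t2
  have tφ3 : Tendsto (iteratedDeriv 3 φ) atTop (nhds 0) := by
    have := (((ta.mul tφ1).add (t1.mul tφ)).sub (ofReal_tendsto0 hl.tF)).const_mul
      (k / Complex.I)
    simp only [mul_zero, zero_mul, add_zero, sub_zero] at this
    refine this.congr' ?_
    filter_upwards [eventually_ge_atTop 0] with y hy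
    rw [← hode y hy]
    have : (k : ℂ) ≠ 0 := by exact_mod_cast hk0
    have := Complex.I_ne_zero
    field_simp
    ring
  have tφ2 := deriv_mid_tendsto b2 b3 tφ1 tφ3
  have tP : Tendsto (fun y => Ψ y + Pz U u1 μ y) atTop (nhds (L / (μ - 1))) := by
    refine (tφ.div ta ha1).congr fun y => ?_
    simp only [Pi.div_apply]
    rw [hφ y, mul_div_cancel_left₀ _ (ha y)]
  have tq' : Tendsto (fun y => q y + pz U u1 μ y) atTop (nhds 0) := by
    have := (tφ1.add (t1.mul tP)).div ta ha1
    rw [zero_mul, add_zero, zero_div] at this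
    refine this.congr fun y => ?_
    simp only [Pi.div_apply]
    rw [e1 y, sub_add_cancel, mul_div_cancel_left₀ _ (ha y)]
  have tq : Tendsto q atTop (nhds 0) := by
    have := tq'.sub (pz_tendsto hη hμ hl)
    simpa using this
  have tr : Tendsto r atTop (nhds 0) := by
    have := (((tφ2.add (((t1.const_mul 2).mul tq'))).add (t2.mul tP)).div ta ha1).sub
      (pz1_tendsto hη hμ hl)
    simp only [mul_zero, zero_mul, add_zero, sub_zero, zero_div] at this
    refine this.congr fun y => ?_
    simp only [Pi.div_apply]
    rw [e2 y, show ∀ a b c : ℂ, a - b - c + b + c = a by intros; ring,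
      mul_div_cancel_left₀ _ (ha y), add_sub_cancel_right]
  have tΨ : Tendsto (fun y => (μ - 1) * Ψ y) atTop
      (nhds (L - (μ - 1) * ∫ y in Ioi (0:ℝ), pz U u1 μ y)) := by
    have := (tP.sub (Pz_tendsto hη hμ hd hl)).const_mul (μ - 1)
    rw [mul_sub, mul_div_cancel₀ _ ha1] at this
    simpa using this
  refine le_of_tendsto tΨ.norm ?_
  have m0 : 0 < ‖μ‖ := hη.trans_le (mu_low hμ)
  have ev1 : ∀ᶠ y in atTop, ‖r y‖ ≤ 1 := by
    have := tr.norm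
    rw [norm_zero] at this
    exact (this.eventually_lt_const one_pos).mono fun y h => h.le
  have ev2 : ∀ᶠ y in atTop, ‖q y‖ * ‖r y‖ ≤ 1 / ‖μ‖ := by
    have := tq.norm.mul tr.norm
    rw [norm_zero, mul_zero] at this
    exact (this.eventually_lt_const (by positivity)).mono fun y h => h.le
  filter_upwards [ev1, ev2, eventually_ge_atTop 1] with R h1 h2 hR
  have hR0 := zero_le_one.trans hR
  exact H U u1 u2 u3 μ k _ Ψ q r s R hμ hd sol hR hk hkK hq0 (gg_int2 hη hμ hd R hR0)
    (gg_int hη hμ hd R hR0) h1 h2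
end
end

section
open MeasureTheory Filter Set
noncomputable section

theorem ioi_int {f : ℝ → ℝ} (hf : Continuous f) (h0 : ∀ y, 0 ≤ f y) {M : ℝ}
    (hM : ∀ R, 0 ≤ R → ∫ y in (0:ℝ)..R, f y ≤ M) : IntegrableOn f (Ioi 0) := by
  refine integrableOn_Ioi_of_intervalIntegral_norm_bounded (l := atTop) (b := id) M 0
    (fun i => ?_) tendsto_id ?_
  · exact (hf.integrableOn_Icc (a := 0) (b := i)).mono_set Ioc_subset_Icc_self
  · filter_upwards [eventually_ge_atTop 0] with R hR
    have : ∀ y, ‖f y‖ = f y := fun y => Real.norm_of_nonneg (h0 y)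
    simp only [this]
    exact hM R hR

theorem l2_tendsto {f f' : ℝ → ℂ} (hd : ∀ y, HasDerivAt f (f' y) y) (hc : Continuous f')
    (h1 : IntegrableOn (fun y => ‖f y‖^2) (Ioi 0)) (h2 : IntegrableOn (fun y => ‖f' y‖^2) (Ioi 0)) :
    Tendsto f atTop (nhds 0) := by
  have cf : Continuous f := continuous_iff_continuousAt.2 fun y => (hd y).continuousAt
  have d2 : ∀ y ∈ Ioi (0:ℝ), HasDerivAt (fun y => f y ^ 2) (2 * f y * f' y) y := by
    intro y _
    have := (hd y).mul (hd y)
    have e : (fun y => f y ^ 2) = f * f := by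
      funext y
      simp [sq]
    rw [e]
    refine this.congr_deriv ?_
    ring
  have i1 : IntegrableOn (fun y => f y ^ 2) (Ioi 0) := by
    refine Integrable.mono' h1 (by fun_prop) (Eventually.of_forall fun y => ?_)
    rw [norm_pow]
  have i2 : IntegrableOn (fun y => 2 * f y * f' y) (Ioi 0) := by
    refine Integrable.mono' (h1.add h2) (by fun_prop) (Eventually.of_forall fun y => ?_)
    simp only [norm_mul, Complex.norm_ofNat, Pi.add_apply]
    nlinarith [sq_nonneg (‖f y‖ - ‖f' y‖)]
  have t := tendsto_zero_of_hasDerivAt_of_integrableOn_Ioi d2 i2 i1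
  have t2 := t.norm.sqrt
  simp only [norm_pow, norm_zero, Real.sqrt_zero, Real.sqrt_sq (norm_nonneg _)] at t2
  exact tendsto_zero_iff_norm_tendsto_zero.2 t2

section
variable {U u1 u2 u3 : ℝ → ℝ} {μ : ℂ} {B η k : ℝ}

theorem QSol.comb {g Ψ q r s Ψh qh rh sh : ℝ → ℂ} (h : QSol U u1 u2 u3 μ k g Ψ q r s)
    (hh : QSol U u1 u2 u3 μ k (fun _ => 0) Ψh qh rh sh) (t : ℂ) :
    QSol U u1 u2 u3 μ k g (fun y => Ψ y + t * Ψh y) (fun y => q y + t * qh y)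
      (fun y => r y + t * rh y) (fun y => s y + t * sh y) := by
  have c1 := h.cs
  have c2 := hh.cs
  refine ⟨by simp [h.z, hh.z], fun y => (h.dΨ y).add ((hh.dΨ y).const_mul t),
    fun y => (h.dq y).add ((hh.dq y).const_mul t),
    fun y => (h.dr y).add ((hh.dr y).const_mul t), by fun_prop, h.cg, fun y hy => ?_⟩
  simp only [h.eq y hy, hh.eq y hy]
  ring

theorem inv_smooth (hη : 0 < η) (hμ : η ≤ μ.im) (sU : ContDiff ℝ (⊤ : ℕ∞) U) :
    ContDiff ℝ (⊤ : ℕ∞) (fun y => (μ - (U y : ℂ))⁻¹) := by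
  have := ofReal_smooth sU
  exact ContDiff.inv (by fun_prop) (QSol.a_ne (U := U) hη hμ)

theorem gg_smooth (hη : 0 < η) (hμ : η ≤ μ.im) (hd : FlowDat U u1 u2 u3 B)
    (sU : ContDiff ℝ (⊤ : ℕ∞) U) (s1 : ContDiff ℝ (⊤ : ℕ∞) u1) (s2 : ContDiff ℝ (⊤ : ℕ∞) u2)
    (s3 : ContDiff ℝ (⊤ : ℕ∞) u3) : ContDiff ℝ (⊤ : ℕ∞) (gg U u1 u2 u3 μ) := by
  have hp := pz_smooth hη hμ sU s1
  have hP := Pz_smooth hη hμ hd sU s1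
  have hi := inv_smooth hη hμ sU
  have k0 := ofReal_smooth sU
  have k1 := ofReal_smooth s1
  have k2 := ofReal_smooth s2
  have k3 := ofReal_smooth s3
  have ky : ContDiff ℝ (⊤ : ℕ∞) (fun y : ℝ => (y : ℂ)) := Complex.ofRealCLM.contDiff
  unfold gg pz2 pz1
  simp only [div_eq_mul_inv, ← inv_pow]
  push_cast
  fun_prop

theorem qsol_exists (hη : 0 < η) (hμ : η ≤ μ.im)
    (sU : ContDiff ℝ (⊤ : ℕ∞) U) (s1 : ContDiff ℝ (⊤ : ℕ∞) u1) (s2 : ContDiff ℝ (⊤ : ℕ∞) u2)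
    (s3 : ContDiff ℝ (⊤ : ℕ∞) u3) {g : ℝ → ℂ} (sg : ContDiff ℝ (⊤ : ℕ∞) g) (x1 x2 : ℂ) :
    ∃ Ψ q r s : ℝ → ℂ, QSol U u1 u2 u3 μ k g Ψ q r s ∧ q 0 = x1 ∧ r 0 = x2 ∧
      ContDiff ℝ (⊤ : ℕ∞) Ψ := by
  have hi := inv_smooth hη hμ sU
  have k0 := ofReal_smooth sU
  have k1 := ofReal_smooth s1
  have k2 := ofReal_smooth s2
  have k3 := ofReal_smooth s3
  obtain ⟨Ψ, q, r, z0, z1, z2, sΨ, d0, d1, d2⟩ := ode3 (fun y => u3 y * (μ - (U y : ℂ))⁻¹)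
    (fun y => -Complex.I * k * (μ - U y) + 3 * u2 y * (μ - (U y : ℂ))⁻¹)
    (fun y => 3 * u1 y * (μ - (U y : ℂ))⁻¹) (fun y => - g y)
    (by fun_prop) (by fun_prop) (by fun_prop) (by fun_prop) 0 x1 x2
  have cΨ := sΨ.continuous
  have cq : Continuous q := continuous_iff_continuousAt.2 fun y => (d1 y).continuousAt
  have cr : Continuous r := continuous_iff_continuousAt.2 fun y => (d2 y).continuousAt
  have := hi.continuous
  have := k0.continuous
  have := k1.continuous
  have := k2.continuous
  have := k3.continuous
  have cg := sg.continuous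
  refine ⟨Ψ, q, r, _, ⟨z0, d0, d1, d2, by fun_prop, cg, fun y _ => ?_⟩, z1, z2, sΨ⟩
  rw [div_eq_mul_inv]
  ring

/-- existence of a solution with finite energy -/
theorem energy_exists (hη : 0 < η) (hμ : η ≤ μ.im) (hd : FlowDat U u1 u2 u3 B)
    (sU : ContDiff ℝ (⊤ : ℕ∞) U) (s1 : ContDiff ℝ (⊤ : ℕ∞) u1) (s2 : ContDiff ℝ (⊤ : ℕ∞) u2)
    (s3 : ContDiff ℝ (⊤ : ℕ∞) u3) (hk : 1 ≤ k) (hkK : 2 * QSol.K1 B η ≤ k * η) :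
    ∃ Ψ q r s : ℝ → ℂ, QSol U u1 u2 u3 μ k (gg U u1 u2 u3 μ) Ψ q r s ∧ q 0 = 1/μ - 1/μ^2 ∧
      ContDiff ℝ (⊤ : ℕ∞) Ψ ∧ ∃ M : ℝ, ∀ R, 0 ≤ R →
        (∫ y in (0:ℝ)..R, ‖r y‖^2) + (∫ y in (0:ℝ)..R, ‖q y‖^2) ≤ M := by
  obtain ⟨C, hC, H⟩ := QSol.energy3 B η (1 + 1/η) (Gg B η) hη (by positivity)
    (Gg_nonneg hη hd.one_le) hd.one_le
  have m0 : 0 < ‖μ‖ := hη.trans_le (mu_low hμ)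
  obtain ⟨Ψ, q, r, s, hA, q0, r0, sΨ⟩ := qsol_exists (k := k) hη hμ sU s1 s2 s3
    (gg_smooth hη hμ hd sU s1 s2 s3) (1/μ - 1/μ^2) 0
  obtain ⟨Ψh, qh, rh, sh, hh, qh0, rh0, sΨh⟩ := qsol_exists (k := k) (g := fun _ => 0) hη hμ
    sU s1 s2 s3 contDiff_const 0 1
  have hne : ∀ R, 1 ≤ R → qh R ≠ 0 := by
    intro R hR h0
    have := (H U u1 u2 u3 μ k _ _ _ _ _ R hμ hd (hh.comb hh ((C * √k : ℝ) : ℂ)) hR hk hkK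
      (by simp only [qh0, mul_zero, add_zero, norm_zero]; positivity)
      (by
        simp only [norm_zero]
        have := Gg_nonneg hη hd.one_le
        simp only [ne_eq, OfNat.ofNat_ne_zero, not_false_eq_true, zero_pow,
          intervalIntegral.integral_zero]
        positivity)
      (by simp only [h0, mul_zero, add_zero, norm_zero, zero_mul]; positivity)).1
    simp only [rh0, mul_one] at this
    rw [← Complex.ofReal_one, ← Complex.ofReal_add, Complex.norm_real, Real.norm_of_nonneg
      (by positivity)] at this
    linarith
  have hn : ∀ n : ℕ, (1:ℝ) ≤ (n:ℝ) + 1 := fun n => by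
    have : (0:ℝ) ≤ n := n.cast_nonneg
    linarith
  set t : ℕ → ℂ := fun n => - q (n+1) / qh (n+1) with ht
  have hz : ∀ n : ℕ, q ((n:ℝ)+1) + t n * qh ((n:ℝ)+1) = 0 := by
    intro n
    simp only [ht]
    rw [div_mul_cancel₀ _ (hne _ (hn n))]
    ring
  have E := fun n : ℕ => H U u1 u2 u3 μ k _ _ _ _ _ ((n:ℝ)+1) hμ hd (hA.comb hh (t n)) (hn n) hk
      hkK (by simp only [q0, qh0, mul_zero, add_zero]; exact q0_bd hη hμ)
      (gg_int2 hη hμ hd _ (zero_le_one.trans (hn n)))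
      (by rw [hz n, norm_zero, zero_mul]; positivity)
  have tb : ∀ n, t n ∈ Metric.closedBall (0:ℂ) (C * √k) := by
    intro n
    have := (E n).1
    simp only [r0, rh0, mul_one, zero_add] at this
    simpa using this
  obtain ⟨τ, -, ν, hν, lim⟩ := tendsto_subseq_of_bounded Metric.isBounded_closedBall tb
  refine ⟨_, _, _, _, hA.comb hh τ, by simp only [q0, qh0, mul_zero, add_zero],
    sΨ.add (contDiff_const.mul sΨh), C * √k, fun R hR => ?_⟩
  have cq := hA.cq
  have cr := hA.cr
  have cqh := hh.cq
  have crh := hh.cr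
  have K1 : Continuous (fun τ : ℂ => ∫ y in (0:ℝ)..R, ‖r y + τ * rh y‖^2) := by
    apply intervalIntegral.continuous_parametric_intervalIntegral_of_continuous'
    simp only [Function.uncurry_def]
    fun_prop
  have K2 : Continuous (fun τ : ℂ => ∫ y in (0:ℝ)..R, ‖q y + τ * qh y‖^2) := by
    apply intervalIntegral.continuous_parametric_intervalIntegral_of_continuous'
    simp only [Function.uncurry_def]
    fun_prop
  have T := ((K1.add K2).tendsto τ).comp lim
  refine le_of_tendsto T ?_
  have ev : ∀ᶠ n : ℕ in atTop, R ≤ (ν n : ℝ) := by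
    have : Tendsto (fun n => ((ν n : ℕ) : ℝ)) atTop atTop :=
      tendsto_natCast_atTop_atTop.comp hν.tendsto_atTop
    exact this.eventually_ge_atTop R
  filter_upwards [ev] with n hRn
  refine le_trans ?_ (E (ν n)).2
  simp only [Function.comp_apply]
  have hR' : R ≤ (ν n : ℝ) + 1 := by linarith
  apply add_le_add
  · apply intervalIntegral.integral_mono_interval le_rfl hR hR'
    · exact Eventually.of_forall fun t => sq_nonneg _
    · apply Continuous.intervalIntegrable; fun_prop
  · apply intervalIntegral.integral_mono_interval le_rfl hR hR'
    · exact Eventually.of_forall fun t => sq_nonneg _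
    · apply Continuous.intervalIntegrable; fun_prop

theorem sol_exists (hη : 0 < η) (hμ : η ≤ μ.im) (hd : FlowDat U u1 u2 u3 B)
    (hl : FlowLim U u1 u2)
    (sU : ContDiff ℝ (⊤ : ℕ∞) U) (s1 : ContDiff ℝ (⊤ : ℕ∞) u1) (s2 : ContDiff ℝ (⊤ : ℕ∞) u2)
    (s3 : ContDiff ℝ (⊤ : ℕ∞) u3) (hU0 : U 0 = 0) (hk : 1 ≤ k)
    (hkK : 2 * QSol.K1 B η ≤ k * η) :
    ∃ (φ : ℝ → ℂ) (L : ℂ), ContDiff ℝ (⊤ : ℕ∞) φ ∧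
      (∀ y, 0 ≤ y → (μ - (U y : ℂ)) * deriv φ y + ((u1 y : ℝ) : ℂ) * φ y
        - Complex.I / (k : ℂ) * iteratedDeriv 3 φ y = ((1 - U y + y * u1 y : ℝ) : ℂ)) ∧
      φ 0 = 0 ∧ deriv φ 0 = 1 ∧ Tendsto (deriv φ) atTop (nhds 0) ∧ Tendsto φ atTop (nhds L) := by
  obtain ⟨Ψ, q, r, s, h, q0, sΨ, M, hM⟩ := energy_exists hη hμ hd sU s1 s2 s3 hk hkK
  have hk0 : k ≠ 0 := by positivity
  have hB : 0 ≤ B := zero_le_one.trans hd.one_le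
  have ha := QSol.a_ne (U := U) hη hμ
  have ta := a_tendsto (μ := μ) hl
  have ha1 := mu_sub_one_ne hη hμ
  have cΨ := h.cΨ
  have cq := h.cq
  have cr := h.cr
  have cs := h.cs
  have cg := h.cg
  have c3 := hd.c3
  have pos : ∀ (f : ℝ → ℂ) R, 0 ≤ R → 0 ≤ ∫ y in (0:ℝ)..R, ‖f y‖^2 := fun f R hR =>
    intervalIntegral.integral_nonneg hR fun y _ => sq_nonneg _
  have Mr : ∀ R, 0 ≤ R → ∫ y in (0:ℝ)..R, ‖r y‖^2 ≤ M := fun R hR => by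
    linarith [hM R hR, pos q R hR]
  have Mq : ∀ R, 0 ≤ R → ∫ y in (0:ℝ)..R, ‖q y‖^2 ≤ M := fun R hR => by
    linarith [hM R hR, pos r R hR]
  have ir : IntegrableOn (fun y => ‖r y‖^2) (Ioi 0) :=
    ioi_int (by fun_prop) (fun y => sq_nonneg _) Mr
  have iq : IntegrableOn (fun y => ‖q y‖^2) (Ioi 0) :=
    ioi_int (by fun_prop) (fun y => sq_nonneg _) Mq
  have ig : IntegrableOn (fun y => ‖gg U u1 u2 u3 μ y‖^2) (Ioi 0) :=
    ioi_int (by fun_prop) (fun y => sq_nonneg _) (gg_int2 hη hμ hd)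
  have iu : IntegrableOn (fun y => u3 y ^ 2 * ‖Ψ y‖^2) (Ioi 0) :=
    ioi_int (M := B * M) (by fun_prop) (fun y => by positivity) (fun R hR =>
      (h.u3psi hd hR le_rfl).trans (mul_le_mul_of_nonneg_left (Mq R hR) hB))
  have is : IntegrableOn (fun y => ‖s y‖^2) (Ioi 0) := by
    set α := k * (‖μ‖ + 1) + 3 * B / η with hα
    set β := 3 * B / η with hβ
    have dom : IntegrableOn (fun y => 4 * (α^2 * ‖q y‖^2 + ‖gg U u1 u2 u3 μ y‖^2
      + β^2 * ‖r y‖^2 + (1/η)^2 * (u3 y ^ 2 * ‖Ψ y‖^2))) (Ioi 0) :=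
      ((((iq.const_mul _).add ig).add (ir.const_mul _)).add (iu.const_mul _)).const_mul 4
    refine Integrable.mono' dom (by fun_prop) ?_
    refine (ae_restrict_iff' measurableSet_Ioi).2 (Eventually.of_forall fun y hy => ?_)
    have hy0 : (0:ℝ) ≤ y := le_of_lt hy
    have hs : ‖s y‖ ≤ α * ‖q y‖ + ‖gg U u1 u2 u3 μ y‖ + β * ‖r y‖ + 1/η * (|u3 y| * ‖Ψ y‖) := by
      rw [h.eq y hy0]
      refine (norm_add_le _ _).trans ?_
      have w := QSol.w_bd hη hμ hd y hy0 (Ψ y) (q y) (r y)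
      have v := norm_sub_le (-Complex.I * k * (μ - U y) * q y) (gg U u1 u2 u3 μ y)
      have an : ‖μ - (U y : ℂ)‖ ≤ ‖μ‖ + 1 := by
        refine (norm_sub_le _ _).trans ?_
        have hu := hd.U01 y hy0
        rw [Complex.norm_real, Real.norm_eq_abs, abs_of_nonneg hu.1]
        linarith [hu.2]
      have v2 : ‖-Complex.I * k * (μ - U y) * q y‖ ≤ k * (‖μ‖ + 1) * ‖q y‖ := by
        rw [norm_mul, norm_mul, norm_mul, norm_neg, Complex.norm_I, one_mul, Complex.norm_real,
          Real.norm_of_nonneg (by positivity)]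
        gcongr
      have e : (3 * B * ‖r y‖ + 3 * B * ‖q y‖ + |u3 y| * ‖Ψ y‖) / η
        = β * ‖r y‖ + β * ‖q y‖ + 1/η * (|u3 y| * ‖Ψ y‖) := by
        rw [hβ]; ring
      rw [e] at w
      have : α * ‖q y‖ = k * (‖μ‖ + 1) * ‖q y‖ + β * ‖q y‖ := by rw [hα, hβ]; ring
      linarith
    rw [Real.norm_of_nonneg (sq_nonneg _)]
    have sq4 : ∀ a b c d : ℝ, (a + b + c + d)^2 ≤ 4 * (a^2 + b^2 + c^2 + d^2) := by
      intro a b c d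
      nlinarith [sq_nonneg (a-b), sq_nonneg (a-c), sq_nonneg (a-d), sq_nonneg (b-c),
        sq_nonneg (b-d), sq_nonneg (c-d)]
    refine (pow_le_pow_left₀ (norm_nonneg _) hs 2).trans ((sq4 _ _ _ _).trans (le_of_eq ?_))
    rw [mul_pow, mul_pow, mul_pow, mul_pow, sq_abs]
  have tq := l2_tendsto h.dq cr iq ir
  have tr := l2_tendsto h.dr cs ir is
  have irest : IntegrableOn (QSol.rest U u1 u2 u3 μ (gg U u1 u2 u3 μ) Ψ q r) (Ioi 0) := by
    have crest := QSol.c_rest hη hμ hd h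
    have hw : ∀ y, 0 ≤ y → ‖1 / (μ - (U y : ℂ))‖ ≤ 1/η := by
      intro y _
      rw [norm_div, norm_one]
      exact one_div_le_one_div_of_le hη (QSol.a_low hμ y)
    refine integrableOn_Ioi_of_intervalIntegral_norm_bounded (l := atTop) (b := id)
      (1/η * ((5 * B + 2 * M + (2 + B) * M) / η + Gg B η)) 0
      (fun i => ?_) tendsto_id ?_
    · exact (crest.integrableOn_Icc (a := 0) (b := i)).mono_set Ioc_subset_Icc_self
    · filter_upwards [eventually_ge_atTop 0] with R hR
      have := QSol.rest_bd hη hμ hd h hR hw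
      simp only [one_mul] at this
      refine this.trans ?_
      have x1 := Mr R hR
      have x2 := Mq R hR
      have x3 := gg_int hη hμ hd R hR
      gcongr
  have tI := intervalIntegral_tendsto_integral_Ioi 0 irest tendsto_id
  have hk' : (k : ℂ) ≠ 0 := by exact_mod_cast hk0
  have hIk : -Complex.I * k ≠ 0 := mul_ne_zero (neg_ne_zero.2 Complex.I_ne_zero) hk'
  have tΨ : ∃ l, Tendsto Ψ atTop (nhds l) := by
    have := ((((tr.div ta ha1).sub_const (r 0 / (μ - U 0))).add tI)).const_mul (-Complex.I * k)⁻¹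
    refine ⟨_, this.congr' ?_⟩
    filter_upwards [eventually_ge_atTop 0] with R hR
    have e := QSol.repr hη hμ hd h hR
    simp only [Pi.div_apply, id]
    rw [← e, inv_mul_cancel_left₀ hIk]
  obtain ⟨l, tΨ⟩ := tΨ
  have tP := Pz_tendsto hη hμ hd hl
  have sP := Pz_smooth hη hμ hd sU s1
  have k0 := ofReal_smooth sU
  have hPz0 : Pz U u1 μ 0 = 0 := by simp [Pz]
  obtain ⟨e1, -, -, -, e2, e3⟩ := bridge hη hμ hd h.dΨ h.dq h.dr
    (φ := fun y => (μ - U y) * (Ψ y + Pz U u1 μ y)) (fun y => rfl)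
  refine ⟨fun y => (μ - U y) * (Ψ y + Pz U u1 μ y), _, by fun_prop, fun y hy => ?_, ?_, ?_, ?_,
    ta.mul (tΨ.add tP)⟩
  · exact (ode_iff hη hμ hk0 y _ _ _ _ _ _ _ rfl (e1 y) (e3 y)).2 (h.eq y hy)
  · simp [h.z, hPz0]
  · rw [e1 0, h.z, hPz0, add_zero, mul_zero, sub_zero]
    exact (q0_eq hη hμ hU0).2 q0
  · have := (ta.mul (tq.add (pz_tendsto hη hμ hl))).sub
      ((ofReal_tendsto0 hl.t1).mul (tΨ.add tP))
    simp only [add_zero, mul_zero, zero_mul, sub_zero] at this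
    refine this.congr fun y => ?_
    exact (e1 y).symm
end
end
end

/-- Lemma (convergence of the inviscid approximation: `|Φ(μ,k) - Φ_inv(μ)| ≤ C k^{-1/2}`). -/
theorem convergence_inviscid_approx (U ω : ℝ → ℝ)
    (hU : AdmissibleShearFlow U) (hω : WeightFn ω) (hdec : WeightedDecay U ω)
    (η : ℝ) (hη : 0 < η) :
    ∃ C K : ℝ, 0 < C ∧ 0 < K ∧
      ∀ μ : ℂ, η ≤ μ.im → ∀ k : ℕ, K ≤ (k : ℝ) →
        (∃ φ : ℝ → ℂ, ∃ L : ℂ,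
          IsBLSolution U μ (k : ℝ) φ ∧ Tendsto φ atTop (nhds L)) ∧
        ∀ φ : ℝ → ℂ, ∀ L : ℂ, IsBLSolution U μ (k : ℝ) φ →
          Tendsto φ atTop (nhds L) →
          ‖L - PhiInv U μ‖ ≤ C * (k : ℝ) ^ (-(1:ℝ)/2) := by
  obtain ⟨⟨B, hd⟩, hl⟩ := flow_exists hU hω hdec
  obtain ⟨C, hC, H⟩ := apriori B η hη hd.one_le
  have sm : ∀ n : ℕ, ContDiff ℝ (⊤ : ℕ∞) (iteratedDeriv n U) := fun n => by
    rw [iteratedDeriv_eq_iterate]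
    exact ContDiff.iterate_deriv n hU.smooth
  have s1 : ContDiff ℝ (⊤ : ℕ∞) (deriv U) := by
    rw [← iteratedDeriv_one]; exact sm 1
  refine ⟨C, max 1 (2 * QSol.K1 B η / η), hC, lt_max_of_lt_left one_pos, ?_⟩
  intro μ hμ k hk
  have hk1 : (1:ℝ) ≤ (k:ℝ) := (le_max_left _ _).trans hk
  have hkK : 2 * QSol.K1 B η ≤ (k:ℝ) * η := by
    have := (le_max_right _ _).trans hk
    rwa [div_le_iff₀ hη] at this
  constructor
  · obtain ⟨φ, L, h1, h2, h3, h4, h5, h6⟩ := sol_exists hη hμ hd hl hU.smooth s1 (sm 2) (sm 3)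
      hU.zero_val hk1 hkK
    exact ⟨φ, L, ⟨h1, h2, h3, h4, h5⟩, h6⟩
  · intro φ L h hL
    obtain ⟨h1, h2, h3, h4, h5⟩ := h
    exact H U _ _ _ μ k φ L hμ hd hl hU.smooth s1 hU.zero_val hk1 hkK h1 h2 h3 h4 h5 hL

end
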